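/- arXiv:1406.3959 — 3 statements merged into one kernel-verified Lean document; each statement's English description precedes it below -/
import Mathlib

section
/- Let ζ : H^{(2)} → H^{A₁} be the homomorphism with ζ(U₁) = T, ζ(U₀) = Y²·T⁻¹, ζ(V₀) = q^{1/4}·Y·T⁻¹·X⁻¹, ζ(V₁) = q^{1/4}·X·T·Y. On H^{A₁}, let τ₊, τ₋ be the R₁-algebra automorphisms determined by τ₊: X ↦ X, T ↦ T, Y ↦ q^{−1/4}·X·Y and τ₋: Y ↦ Y, T ↦ T, X ↦ q^{1/4}·Y·X, and let η be the ring automorphism with η(X) = X⁻¹, η(T) = T⁻¹, η(Y) = T·Y⁻¹·T⁻¹, semilinear over the base-ring automorphism q^{1/4} ↦ q^{−1/4}, t^{1/2} ↦ t^{−1/2}. On H^{(2)}, let τ₋ be the R₁-algebra automorphism determined by U₀ ↦ U₀, U₁ ↦ U₁, V₁ ↦ q^{−1/2}·V₁⁻¹·𝕐⁻¹, V₀ ↦ V₀⁻¹·V₁·V₀; let τ₊² be the R₁-algebra automorphism determined by U₁ ↦ U₁, V₁ ↦ V₁, U₀ ↦ 𝕏·U₀·𝕏⁻¹, V₀ ↦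 𝕏·V₀·𝕏⁻¹; and let η be the ring automorphism with U₁ ↦ U₁⁻¹, U₀ ↦ U₀⁻¹, V₁ ↦ U₁·V₁⁻¹·U₁⁻¹, V₀ ↦ U₀⁻¹·V₀⁻¹·U₀, semilinear over q^{1/4} ↦ q^{−1/4}, t^{1/2} ↦ t^{−1/2} (here 𝕏 = V₁⁻¹·U₁⁻¹, 𝕐 = U₀·U₁ in H^{(2)}). Then all these maps exist (i.e. the assignments respect the defining relations and are bijective) and ζ ∘ τ₊² = (τ₋⁻¹ ∘ τ₊ ∘ τ₋) ∘ ζ, ζ ∘ τ₋ = τ₋² ∘ ζ, and ζ ∘ η = (τ₋⁻¹ ∘ η ∘ τ₋) ∘ ζ as maps H^{(2)} → H^{A₁}. -/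
noncomputable section

/-- The base ring `R₁ = ℤ[q^{±1/4}, t^{±1/2}]`: the group algebra of `ℤ × ℤ` over `ℤ`,
where `q^{1/4}` corresponds to the exponent `(1,0)` and `t^{1/2}` to `(0,1)`. -/
abbrev R1 : Type := AddMonoidAlgebra ℤ (ℤ × ℤ)

/-- `q^{1/4}` -/
def R1.q4 : R1 := AddMonoidAlgebra.single (1, 0) 1
/-- `q^{-1/4}` -/
def R1.q4i : R1 := AddMonoidAlgebra.single (-1, 0) 1
/-- `t^{1/2}` -/
def R1.t2 : R1 := AddMonoidAlgebra.single (0, 1) 1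
/-- `t^{-1/2}` -/
def R1.t2i : R1 := AddMonoidAlgebra.single (0, -1) 1
/-- `q^{1/2}` -/
def R1.q2 : R1 := AddMonoidAlgebra.single (2, 0) 1
/-- `q^{-1/2}` -/
def R1.q2i : R1 := AddMonoidAlgebra.single (-2, 0) 1

/-- Generators of the DAHA of type `A₁`: `T, T⁻¹, X, X⁻¹, Y, Y⁻¹`. -/
inductive A1gen : Type
  | t | ti | x | xi | y | yi

open FreeAlgebra in
/-- The defining relations of the DAHA of type `A₁`. -/
inductive A1rel : FreeAlgebra R1 A1gen → FreeAlgebra R1 A1gen → Prop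
  | tti : A1rel (ι R1 A1gen.t * ι R1 A1gen.ti) 1
  | tit : A1rel (ι R1 A1gen.ti * ι R1 A1gen.t) 1
  | xxi : A1rel (ι R1 A1gen.x * ι R1 A1gen.xi) 1
  | xix : A1rel (ι R1 A1gen.xi * ι R1 A1gen.x) 1
  | yyi : A1rel (ι R1 A1gen.y * ι R1 A1gen.yi) 1
  | yiy : A1rel (ι R1 A1gen.yi * ι R1 A1gen.y) 1
  | hecke : A1rel ((ι R1 A1gen.t - algebraMap R1 _ R1.t2) *
      (ι R1 A1gen.t + algebraMap R1 _ R1.t2i)) 0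
  | txt : A1rel (ι R1 A1gen.t * ι R1 A1gen.x * ι R1 A1gen.t) (ι R1 A1gen.xi)
  | tiyti : A1rel (ι R1 A1gen.ti * ι R1 A1gen.y * ι R1 A1gen.ti) (ι R1 A1gen.yi)
  | cross : A1rel (ι R1 A1gen.yi * ι R1 A1gen.xi * ι R1 A1gen.y * ι R1 A1gen.x *
      ι R1 A1gen.t * ι R1 A1gen.t * algebraMap R1 _ R1.q2) 1

/-- The DAHA of type `A₁`. -/
abbrev HA1 : Type := RingQuot A1rel

namespace HA1

def T : HA1 := RingQuot.mkAlgHom R1 A1rel (FreeAlgebra.ι R1 A1gen.t)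
def Ti : HA1 := RingQuot.mkAlgHom R1 A1rel (FreeAlgebra.ι R1 A1gen.ti)
def X : HA1 := RingQuot.mkAlgHom R1 A1rel (FreeAlgebra.ι R1 A1gen.x)
def Xi : HA1 := RingQuot.mkAlgHom R1 A1rel (FreeAlgebra.ι R1 A1gen.xi)
def Y : HA1 := RingQuot.mkAlgHom R1 A1rel (FreeAlgebra.ι R1 A1gen.y)
def Yi : HA1 := RingQuot.mkAlgHom R1 A1rel (FreeAlgebra.ι R1 A1gen.yi)

/-- image of a base-ring element in `H^{A₁}` -/
def c (r : R1) : HA1 := algebraMap R1 HA1 r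

end HA1

open HA1

/-- Generators `U₀, U₁, V₀, V₁` of `H^{(2)}`. -/
inductive Cgen : Type
  | u0 | u1 | v0 | v1

open FreeAlgebra in
/-- Defining relations of `H^{(2)}`, the `C∨C₁` DAHA with `q` replaced by `q²` and
parameters `u₀ = u₁ = t`, `v₀ = v₁ = 1`. -/
inductive H2Rel : FreeAlgebra R1 Cgen → FreeAlgebra R1 Cgen → Prop
  | heckeU0 : H2Rel ((ι R1 Cgen.u0 - algebraMap R1 _ R1.t2) *
      (ι R1 Cgen.u0 + algebraMap R1 _ R1.t2i)) 0
  | heckeU1 : H2Rel ((ι R1 Cgen.u1 - algebraMap R1 _ R1.t2) *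
      (ι R1 Cgen.u1 + algebraMap R1 _ R1.t2i)) 0
  | v0sq : H2Rel (ι R1 Cgen.v0 * ι R1 Cgen.v0) 1
  | v1sq : H2Rel (ι R1 Cgen.v1 * ι R1 Cgen.v1) 1
  | unit : H2Rel (algebraMap R1 _ R1.q2 * ι R1 Cgen.v1 * ι R1 Cgen.v0 *
      ι R1 Cgen.u0 * ι R1 Cgen.u1) 1

/-- The DAHA `H^{(2)}`. -/
abbrev H2 : Type := RingQuot H2Rel

namespace H2

def U0 : H2 := RingQuot.mkAlgHom R1 H2Rel (FreeAlgebra.ι R1 Cgen.u0)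
def U1 : H2 := RingQuot.mkAlgHom R1 H2Rel (FreeAlgebra.ι R1 Cgen.u1)
def V0 : H2 := RingQuot.mkAlgHom R1 H2Rel (FreeAlgebra.ι R1 Cgen.v0)
def V1 : H2 := RingQuot.mkAlgHom R1 H2Rel (FreeAlgebra.ι R1 Cgen.v1)

/-- `U₁⁻¹ = U₁ − t^{1/2} + t^{−1/2}` -/
def U1i : H2 := U1 - algebraMap R1 H2 R1.t2 + algebraMap R1 H2 R1.t2i
/-- `U₀⁻¹ = U₀ − t^{1/2} + t^{−1/2}` -/
def U0i : H2 := U0 - algebraMap R1 H2 R1.t2 + algebraMap R1 H2 R1.t2i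
/-- `V₁⁻¹ = V₁` (here `v₁ = 1`) -/
def V1i : H2 := V1
/-- `𝕏 = V₁⁻¹·U₁⁻¹` -/
def XX : H2 := V1i * U1i
/-- `𝕐 = U₀·U₁` -/
def YY : H2 := U0 * U1

end H2

section Statement4

/-- conditions on `τ₊ : H^{A₁} → H^{A₁}` -/
def TauPlusA1 (τp : HA1 ≃ₐ[R1] HA1) : Prop :=
  τp X = X ∧ τp T = T ∧ τp Y = c R1.q4i * X * Y

/-- conditions on `τ₋ : H^{A₁} → H^{A₁}` -/
def TauMinusA1 (τm : HA1 ≃ₐ[R1] HA1) : Prop :=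
  τm Y = Y ∧ τm T = T ∧ τm X = c R1.q4 * Y * X

/-- `η` on `H^{A₁}`, semilinear over `θ : q^{1/4} ↦ q^{−1/4}, t^{1/2} ↦ t^{−1/2}` -/
def EtaA1 (θ : R1 ≃+* R1) (η : HA1 ≃+* HA1) : Prop :=
  (∀ r : R1, η (algebraMap R1 HA1 r) = algebraMap R1 HA1 (θ r)) ∧
  η X = Xi ∧ η T = Ti ∧ η Y = T * Yi * Ti

/-- conditions on `ζ : H^{(2)} → H^{A₁}` -/
def ZetaMap (ζ : H2 →ₐ[R1] HA1) : Prop :=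
  ζ H2.U1 = T ∧ ζ H2.U0 = Y * Y * Ti ∧
  ζ H2.V0 = c R1.q4 * Y * Ti * Xi ∧ ζ H2.V1 = c R1.q4 * X * T * Y

/-- `τ₋` on `H^{(2)}`: `U₀ ↦ U₀, U₁ ↦ U₁, V₁ ↦ q^{−1/2}·V₁⁻¹·𝕐⁻¹, V₀ ↦ V₀⁻¹·V₁·V₀`
(note `V₀⁻¹ = V₀`, `V₁⁻¹ = V₁`, `𝕐⁻¹ = U₁⁻¹·U₀⁻¹` in `H^{(2)}`). -/
def TauMinusH2 (τ : H2 ≃ₐ[R1] H2) : Prop :=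
  τ H2.U0 = H2.U0 ∧ τ H2.U1 = H2.U1 ∧
  τ H2.V1 = algebraMap R1 H2 R1.q2i * H2.V1i * (H2.U1i * H2.U0i) ∧
  τ H2.V0 = H2.V0 * H2.V1 * H2.V0

/-- `τ₊²` on `H^{(2)}`: `U₁ ↦ U₁, V₁ ↦ V₁, U₀ ↦ 𝕏·U₀·𝕏⁻¹, V₀ ↦ 𝕏·V₀·𝕏⁻¹`
(with `𝕏⁻¹ = U₁·V₁`). -/
def TauPlusSqH2 (τ : H2 ≃ₐ[R1] H2) : Prop :=
  τ H2.U1 = H2.U1 ∧ τ H2.V1 = H2.V1 ∧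
  τ H2.U0 = H2.XX * H2.U0 * (H2.U1 * H2.V1) ∧
  τ H2.V0 = H2.XX * H2.V0 * (H2.U1 * H2.V1)

/-- `η` on `H^{(2)}`: `U₁ ↦ U₁⁻¹, U₀ ↦ U₀⁻¹, V₁ ↦ U₁·V₁⁻¹·U₁⁻¹, V₀ ↦ U₀⁻¹·V₀⁻¹·U₀`,
semilinear over `θ`. -/
def EtaH2 (θ : R1 ≃+* R1) (η : H2 ≃+* H2) : Prop :=
  (∀ r : R1, η (algebraMap R1 H2 r) = algebraMap R1 H2 (θ r)) ∧
  η H2.U1 = H2.U1i ∧ η H2.U0 = H2.U0i ∧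
  η H2.V1 = H2.U1 * H2.V1i * H2.U1i ∧ η H2.V0 = H2.U0i * H2.V0 * H2.U0

namespace R1

@[simp] theorem q4_mul_q4i : q4 * q4i = 1 := by
  simp [q4, q4i, AddMonoidAlgebra.single_mul_single, AddMonoidAlgebra.one_def,
    Prod.mk_zero_zero]

@[simp] theorem q4i_mul_q4 : q4i * q4 = 1 := by rw [mul_comm, q4_mul_q4i]

@[simp] theorem q4_mul_q4i_mul (r : R1) : q4 * (q4i * r) = r := by
  rw [← mul_assoc, q4_mul_q4i, one_mul]

@[simp] theorem q4i_mul_q4_mul (r : R1) : q4i * (q4 * r) = r := by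
  rw [← mul_assoc, q4i_mul_q4, one_mul]

@[simp] theorem t2_mul_t2i : t2 * t2i = 1 := by
  simp [t2, t2i, AddMonoidAlgebra.single_mul_single, AddMonoidAlgebra.one_def,
    Prod.mk_zero_zero]

theorem q2_eq : q2 = q4 * q4 := by
  simp [q4, q2, AddMonoidAlgebra.single_mul_single]

theorem q2i_eq : q2i = q4i * q4i := by
  simp [q4i, q2i, AddMonoidAlgebra.single_mul_single]

theorem map_q4i {θ : R1 ≃+* R1} (hq : θ q4 = q4i) : θ q4i = q4 := by
  have h : θ q4 * θ q4i = 1 := by rw [← map_mul, q4_mul_q4i, map_one]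
  rw [hq] at h
  exact (left_inv_eq_right_inv q4_mul_q4i h).symm

theorem map_t2i {θ : R1 ≃+* R1} (ht : θ t2 = t2i) : θ t2i = t2 := by
  have h : θ t2 * θ t2i = 1 := by rw [← map_mul, t2_mul_t2i, map_one]
  rw [ht] at h
  exact (left_inv_eq_right_inv t2_mul_t2i h).symm

theorem symm_q4 {θ : R1 ≃+* R1} (hq : θ q4 = q4i) : θ.symm q4 = q4i := by
  rw [RingEquiv.symm_apply_eq, map_q4i hq]

theorem symm_t2 {θ : R1 ≃+* R1} (ht : θ t2 = t2i) : θ.symm t2 = t2i := by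
  rw [RingEquiv.symm_apply_eq, map_t2i ht]

theorem exists_inversion : ∃ θ : R1 ≃+* R1, θ q4 = q4i ∧ θ t2 = t2i :=
  ⟨(AddMonoidAlgebra.domCongr ℤ ℤ (AddEquiv.neg (ℤ × ℤ))).toRingEquiv, by
    simp [q4, q4i], by simp [t2, t2i]⟩

end R1

section Hecke

variable {A : Type*} [Ring A] [Algebra R1 A] {u v : A}

/-- The Hecke relation with parameter `t^{1/2}`. -/
def IsHecke (u : A) : Prop :=
  (u - algebraMap R1 A R1.t2) * (u + algebraMap R1 A R1.t2i) = 0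

theorem algebraMap_t2_mul_t2i : algebraMap R1 A R1.t2 * algebraMap R1 A R1.t2i = 1 := by
  rw [← map_mul, R1.t2_mul_t2i, map_one]

theorem IsHecke.mul_inv (h : IsHecke u) :
    u * (u - algebraMap R1 A R1.t2 + algebraMap R1 A R1.t2i) = 1 := by
  unfold IsHecke at h
  rw [← sub_eq_zero, ← h, ← algebraMap_t2_mul_t2i (A := A)]
  rw [mul_add, mul_sub, sub_mul, mul_add, mul_add, Algebra.commutes R1.t2 u]
  abel

theorem IsHecke.inv_mul (h : IsHecke u) :
    (u - algebraMap R1 A R1.t2 + algebraMap R1 A R1.t2i) * u = 1 := by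
  rw [← h.mul_inv, add_mul, sub_mul, mul_add, mul_sub, Algebra.commutes, Algebra.commutes]

theorem IsHecke.eq_inv (h : IsHecke u) (huv : u * v = 1) :
    v = u - algebraMap R1 A R1.t2 + algebraMap R1 A R1.t2i :=
  (left_inv_eq_right_inv h.inv_mul huv).symm

/-- The inverse satisfies the Hecke relation with the inverted parameter. -/
theorem IsHecke.inv (h : IsHecke u) (huv : u * v = 1) :
    (v - algebraMap R1 A R1.t2i) * (v + algebraMap R1 A R1.t2) = 0 := by
  rw [h.eq_inv huv, ← h]
  rw [add_sub_cancel_right, add_right_comm, sub_add_cancel]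

theorem IsHecke.conj (h : IsHecke u) {g g' : A} (hg : g * g' = 1) (hg' : g' * g = 1) :
    IsHecke (g * u * g') := by
  have key (r : R1) : algebraMap R1 A r = g * algebraMap R1 A r * g' := by
    rw [← Algebra.commutes, mul_assoc, hg, mul_one]
  unfold IsHecke at h ⊢
  rw [key R1.t2, key R1.t2i, ← sub_mul, ← add_mul, ← mul_sub, ← mul_add]
  calc _ = g * (u - algebraMap R1 A R1.t2) * (g' * g) * (u + algebraMap R1 A R1.t2i) * g' := by
        simp only [mul_assoc]
    _ = g * ((u - algebraMap R1 A R1.t2) * (u + algebraMap R1 A R1.t2i)) * g' := by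
        rw [hg', mul_one, mul_assoc g]
    _ = 0 := by rw [h, mul_zero, zero_mul]

end Hecke

/-- A ring homomorphism carries a two-sided inverse to a two-sided inverse. -/
theorem map_eq_of_inverses {A B F : Type*} [Semiring A] [Semiring B] [FunLike F A B] [RingHomClass F A B]
    (φ : F) {a a' : A} {b b' : B} (ha : a * a' = 1) (hφ : φ a = b) (hb : b' * b = 1) :
    φ a' = b' := by
  have h : φ a * φ a' = 1 := by rw [← map_mul, ha, map_one]
  rw [hφ] at h
  exact (left_inv_eq_right_inv hb h).symm

namespace HA1

theorem T_mul_Ti : T * Ti = 1 := by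
  simpa [T, Ti] using RingQuot.mkAlgHom_rel R1 A1rel.tti

theorem Ti_mul_T : Ti * T = 1 := by
  simpa [T, Ti] using RingQuot.mkAlgHom_rel R1 A1rel.tit

theorem X_mul_Xi : X * Xi = 1 := by
  simpa [X, Xi] using RingQuot.mkAlgHom_rel R1 A1rel.xxi

theorem Xi_mul_X : Xi * X = 1 := by
  simpa [X, Xi] using RingQuot.mkAlgHom_rel R1 A1rel.xix

theorem Y_mul_Yi : Y * Yi = 1 := by
  simpa [Y, Yi] using RingQuot.mkAlgHom_rel R1 A1rel.yyi

theorem Yi_mul_Y : Yi * Y = 1 := by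
  simpa [Y, Yi] using RingQuot.mkAlgHom_rel R1 A1rel.yiy

theorem isHecke_T : IsHecke T := by
  simpa [T, IsHecke] using RingQuot.mkAlgHom_rel R1 A1rel.hecke

theorem T_mul_X_mul_T : T * X * T = Xi := by
  simpa [T, X, Xi] using RingQuot.mkAlgHom_rel R1 A1rel.txt

theorem Ti_mul_Y_mul_Ti : Ti * Y * Ti = Yi := by
  simpa [Ti, Y, Yi] using RingQuot.mkAlgHom_rel R1 A1rel.tiyti

theorem cross : Yi * Xi * Y * X * T * T * algebraMap R1 HA1 R1.q2 = 1 := by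
  simpa [T, X, Xi, Y, Yi] using RingQuot.mkAlgHom_rel R1 A1rel.cross

/-- The first of three involutions which, with the scalars, generate `H^{A₁}`. -/
def I : HA1 := X * T
/-- The second of three involutions which, with the scalars, generate `H^{A₁}`. -/
def J : HA1 := Ti * Y
/-- The third of three involutions which, with the scalars, generate `H^{A₁}`. -/
def K : HA1 := R1.q4 • (X * T * Y)

@[simp] theorem I_mul_I : I * I = 1 := by
  rw [I, ← X_mul_Xi, ← T_mul_X_mul_T]
  simp only [mul_assoc]

@[simp] theorem J_mul_J : J * J = 1 := by
  rw [J, ← Yi_mul_Y, ← Ti_mul_Y_mul_Ti]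
  simp only [mul_assoc]

theorem X_mul_T : X * T = Ti * Xi := by
  rw [← T_mul_X_mul_T]
  simp only [← mul_assoc, Ti_mul_T, one_mul]

theorem Y_mul_Ti : Y * Ti = T * Yi := by
  rw [← Ti_mul_Y_mul_Ti]
  simp only [← mul_assoc, T_mul_Ti, one_mul]

@[simp] theorem K_mul_K : K * K = 1 := by
  have hinv : (X * T * T) * (Ti * Ti * Xi) = 1 := by
    calc _ = X * (T * (T * Ti) * Ti) * Xi := by simp only [mul_assoc]
      _ = 1 := by rw [T_mul_Ti, mul_one, T_mul_Ti, mul_one, X_mul_Xi]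
  have hcross : (R1.q2 • (Yi * Xi * Y)) * (X * T * T) = 1 := by
    rw [← cross, ← Algebra.commutes, ← Algebra.smul_def]
    simp only [smul_mul_assoc, mul_assoc]
  have hcross' : (X * T * T) * (R1.q2 • (Yi * Xi * Y)) = 1 := by
    rw [left_inv_eq_right_inv hcross hinv, hinv]
  calc K * K = R1.q2 • (X * T * Y * (X * T) * Y) := by
        simp only [K, R1.q2_eq, smul_mul_assoc, mul_smul_comm, smul_smul, mul_assoc]
    _ = R1.q2 • (X * T * (Y * Ti) * Xi * Y) := by
        rw [X_mul_T]
        simp only [mul_assoc]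
    _ = 1 := by
        rw [Y_mul_Ti, ← hcross', mul_smul_comm]
        simp only [mul_assoc]

@[simp] theorem I_mul_I_mul (z : HA1) : I * (I * z) = z := by
  rw [← mul_assoc, I_mul_I, one_mul]

@[simp] theorem J_mul_J_mul (z : HA1) : J * (J * z) = z := by
  rw [← mul_assoc, J_mul_J, one_mul]

@[simp] theorem K_mul_K_mul (z : HA1) : K * (K * z) = z := by
  rw [← mul_assoc, K_mul_K, one_mul]

theorem Y_eq : Y = R1.q4i • (I * K) := by
  have h : K = R1.q4 • (I * Y) := rfl
  simp [h, smul_smul]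

theorem T_eq : T = R1.q4i • (I * (K * J)) := by
  have h : T = Y * J := by
    rw [J, ← mul_assoc, Y_mul_Ti, mul_assoc, Yi_mul_Y, mul_one]
  rw [h, Y_eq, smul_mul_assoc, mul_assoc]

theorem Yi_eq : Yi = R1.q4 • (K * I) :=
  left_inv_eq_right_inv Yi_mul_Y (by simp [Y_eq, smul_smul, mul_assoc])

theorem Ti_eq : Ti = R1.q4 • (J * (K * I)) :=
  left_inv_eq_right_inv Ti_mul_T (by simp [T_eq, smul_smul, mul_assoc])

theorem X_eq : X = R1.q4 • (I * (J * (K * I))) := by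
  have h : X = I * Ti := by rw [I, mul_assoc, T_mul_Ti, mul_one]
  rw [h, Ti_eq, mul_smul_comm]

theorem Xi_eq : Xi = R1.q4i • (I * (K * (J * I))) :=
  left_inv_eq_right_inv Xi_mul_X (by simp [X_eq, smul_smul, mul_assoc])

/-- Universal property of `H^{A₁}` for homomorphisms that need not be linear over `R₁`. -/
theorem exists_lift {A : Type*} [Ring A] (f : R1 →+* A) (hf : ∀ r a, f r * a = a * f r)
    {t ti x xi y yi : A} (tti : t * ti = 1) (tit : ti * t = 1) (xxi : x * xi = 1)
    (xix : xi * x = 1) (yyi : y * yi = 1) (yiy : yi * y = 1)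
    (hecke : (t - f R1.t2) * (t + f R1.t2i) = 0) (txt : t * x * t = xi)
    (tiyti : ti * y * ti = yi) (cross : yi * xi * y * x * t * t * f R1.q2 = 1) :
    ∃ φ : HA1 →+* A, (∀ r, φ (algebraMap R1 HA1 r) = f r) ∧ φ T = t ∧ φ X = x ∧ φ Y = y := by
  let _ : Algebra R1 A := f.toAlgebra' hf
  let g : A1gen → A := fun
    | .t => t | .ti => ti | .x => x | .xi => xi | .y => y | .yi => yi
  have hg : ∀ ⦃a b⦄, A1rel a b → FreeAlgebra.lift R1 g a = FreeAlgebra.lift R1 g b := by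
    rintro _ _ (_ | _ | _ | _ | _ | _ | _ | _ | _ | _) <;>
      simp only [map_mul, map_sub, map_add, map_one, map_zero, FreeAlgebra.lift_ι_apply,
        AlgHom.commutes] <;> assumption
  let φ : HA1 →ₐ[R1] A := RingQuot.liftAlgHom R1 ⟨FreeAlgebra.lift R1 g, hg⟩
  have hφ (i : A1gen) : φ (RingQuot.mkAlgHom R1 A1rel (FreeAlgebra.ι R1 i)) = g i := by
    rw [RingQuot.liftAlgHom_mkAlgHom_apply, FreeAlgebra.lift_ι_apply]
  exact ⟨φ.toRingHom, φ.commutes, hφ .t, hφ .x, hφ .y⟩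

theorem ringHom_ext {A : Type*} [Semiring A] {φ ψ : HA1 →+* A}
    (hr : ∀ r, φ (algebraMap R1 HA1 r) = ψ (algebraMap R1 HA1 r))
    (hT : φ T = ψ T) (hX : φ X = ψ X) (hY : φ Y = ψ Y) : φ = ψ := by
  have hTi : φ Ti = ψ Ti :=
    map_eq_of_inverses φ T_mul_Ti hT (by rw [← map_mul, Ti_mul_T, map_one])
  have hXi : φ Xi = ψ Xi :=
    map_eq_of_inverses φ X_mul_Xi hX (by rw [← map_mul, Xi_mul_X, map_one])
  have hYi : φ Yi = ψ Yi :=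
    map_eq_of_inverses φ Y_mul_Yi hY (by rw [← map_mul, Yi_mul_Y, map_one])
  refine RingHom.ext fun z => ?_
  obtain ⟨w, rfl⟩ := RingQuot.mkAlgHom_surjective R1 A1rel z
  induction w using FreeAlgebra.induction with
  | grade0 r => simpa using hr r
  | grade1 i => cases i <;> assumption
  | mul a b ha hb => simp only [map_mul, ha, hb]
  | add a b ha hb => simp only [map_add, ha, hb]

theorem algHom_ext {A : Type*} [Semiring A] [Algebra R1 A] {φ ψ : HA1 →ₐ[R1] A}
    (hT : φ T = ψ T) (hX : φ X = ψ X) (hY : φ Y = ψ Y) : φ = ψ :=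
  AlgHom.coe_ringHom_injective <| ringHom_ext (fun r => by simp) hT hX hY

/-- Linear endomorphisms of `H^{A₁}` that fix `T`, given on `X` and `Y`. -/
theorem exists_algHom {x xi y yi : HA1} (xxi : x * xi = 1)
    (xix : xi * x = 1) (yyi : y * yi = 1) (yiy : yi * y = 1) (txt : T * x * T = xi)
    (tiyti : Ti * y * Ti = yi) (cross : yi * xi * y * x * T * T * algebraMap R1 HA1 R1.q2 = 1) :
    ∃ φ : HA1 →ₐ[R1] HA1, φ T = T ∧ φ X = x ∧ φ Y = y := by
  obtain ⟨φ, hr, h⟩ := exists_lift (A := HA1) (algebraMap R1 HA1) Algebra.commutes T_mul_Ti Ti_mul_T xxi xix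
    yyi yiy (by exact isHecke_T) txt tiyti cross
  exact ⟨{ φ with commutes' := hr }, h⟩

theorem c_eq_smul_one (r : R1) : c r = r • (1 : HA1) := Algebra.algebraMap_eq_smul_one r

attribute [local simp] T_eq Ti_eq X_eq Xi_eq Y_eq Yi_eq c_eq_smul_one R1.q2_eq R1.q2i_eq smul_smul
  mul_assoc Algebra.algebraMap_eq_smul_one

theorem map_Ti {A F : Type*} [Semiring A] [FunLike F HA1 A] [RingHomClass F HA1 A] {φ : F} {t t' : A}
    (h : φ T = t) (ht : t' * t = 1) : φ Ti = t' :=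
  map_eq_of_inverses φ T_mul_Ti h ht

theorem map_Xi {A F : Type*} [Semiring A] [FunLike F HA1 A] [RingHomClass F HA1 A] {φ : F} {x x' : A}
    (h : φ X = x) (hx : x' * x = 1) : φ Xi = x' :=
  map_eq_of_inverses φ X_mul_Xi h hx

theorem map_Yi {A F : Type*} [Semiring A] [FunLike F HA1 A] [RingHomClass F HA1 A] {φ : F} {y y' : A}
    (h : φ Y = y) (hy : y' * y = 1) : φ Yi = y' :=
  map_eq_of_inverses φ Y_mul_Yi h hy

theorem existsUnique_tauPlus : ∃! τp : HA1 ≃ₐ[R1] HA1, TauPlusA1 τp := by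
  obtain ⟨φ, hT, hX, hY⟩ : ∃ φ : HA1 →ₐ[R1] HA1, φ T = T ∧ φ X = X ∧ φ Y = c R1.q4i * X * Y :=
    exists_algHom (xi := Xi) (yi := c R1.q4 * Yi * Xi) (by simp) (by simp) (by simp) (by simp)
      (by simp) (by simp) (by simp)
  obtain ⟨ψ, kT, kX, kY⟩ : ∃ ψ : HA1 →ₐ[R1] HA1, ψ T = T ∧ ψ X = X ∧ ψ Y = c R1.q4 * Xi * Y :=
    exists_algHom (xi := Xi) (yi := c R1.q4i * Yi * X) (by simp) (by simp) (by simp) (by simp)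
      (by simp) (by simp) (by simp)
  have hXi : φ Xi = Xi := map_Xi hX Xi_mul_X
  refine ⟨AlgEquiv.ofAlgHom φ ψ (algHom_ext ?_ ?_ ?_) (algHom_ext ?_ ?_ ?_), ⟨hX, hT, hY⟩, ?_⟩
  · simp only [AlgHom.comp_apply, AlgHom.id_apply, hT, kT]
  · simp only [AlgHom.comp_apply, AlgHom.id_apply, hX, kX]
  · simp only [AlgHom.comp_apply, AlgHom.id_apply, kY, c, map_mul, AlgHom.commutes, hXi, hY]
    simp
  · simp only [AlgHom.comp_apply, AlgHom.id_apply, hT, kT]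
  · simp only [AlgHom.comp_apply, AlgHom.id_apply, hX, kX]
  · simp only [AlgHom.comp_apply, AlgHom.id_apply, kY, c, map_mul, AlgHom.commutes, kX, hY]
    simp
  · rintro τ ⟨lX, lT, lY⟩
    exact AlgEquiv.coe_toAlgHom_injective <|
      algHom_ext (lT.trans hT.symm) (lX.trans hX.symm) (lY.trans hY.symm)

theorem existsUnique_tauMinus : ∃! τm : HA1 ≃ₐ[R1] HA1, TauMinusA1 τm := by
  obtain ⟨φ, hT, hX, hY⟩ : ∃ φ : HA1 →ₐ[R1] HA1, φ T = T ∧ φ X = c R1.q4 * Y * X ∧ φ Y = Y :=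
    exists_algHom (xi := c R1.q4i * Xi * Yi) (yi := Yi) (by simp) (by simp) (by simp) (by simp)
      (by simp) (by simp) (by simp)
  obtain ⟨ψ, kT, kX, kY⟩ : ∃ ψ : HA1 →ₐ[R1] HA1, ψ T = T ∧ ψ X = c R1.q4i * Yi * X ∧ ψ Y = Y :=
    exists_algHom (xi := c R1.q4 * Xi * Y) (yi := Yi) (by simp) (by simp) (by simp) (by simp)
      (by simp) (by simp) (by simp)
  have hYi : φ Yi = Yi := map_Yi hY Yi_mul_Y
  refine ⟨AlgEquiv.ofAlgHom φ ψ (algHom_ext ?_ ?_ ?_) (algHom_ext ?_ ?_ ?_), ⟨hY, hT, hX⟩, ?_⟩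
  · simp only [AlgHom.comp_apply, AlgHom.id_apply, hT, kT]
  · simp only [AlgHom.comp_apply, AlgHom.id_apply, kX, c, map_mul, AlgHom.commutes, hYi, hX]
    simp
  · simp only [AlgHom.comp_apply, AlgHom.id_apply, hY, kY]
  · simp only [AlgHom.comp_apply, AlgHom.id_apply, hT, kT]
  · simp only [AlgHom.comp_apply, AlgHom.id_apply, kX, c, map_mul, AlgHom.commutes, kY, hX]
    simp
  · simp only [AlgHom.comp_apply, AlgHom.id_apply, hY, kY]
  · rintro τ ⟨lY, lT, lX⟩
    exact AlgEquiv.coe_toAlgHom_injective <|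
      algHom_ext (lT.trans hT.symm) (lX.trans hX.symm) (lY.trans hY.symm)

theorem exists_eta {θ : R1 ≃+* R1} (hq : θ R1.q4 = R1.q4i) (ht : θ R1.t2 = R1.t2i) :
    ∃ φ : HA1 →+* HA1, (∀ r, φ (algebraMap R1 HA1 r) = algebraMap R1 HA1 (θ r)) ∧
      φ T = Ti ∧ φ X = Xi ∧ φ Y = T * Yi * Ti :=
  exists_lift (ti := T) (xi := X) (yi := T * Y * Ti) ((algebraMap R1 HA1).comp θ)
    (fun r => Algebra.commutes (θ r)) Ti_mul_T T_mul_Ti Xi_mul_X X_mul_Xi (by simp) (by simp)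
    (by simpa [-T_eq, -Ti_eq, -Algebra.algebraMap_eq_smul_one, ht, R1.map_t2i ht]
      using isHecke_T.inv T_mul_Ti)
    (by simp) (by simp) (by simp [hq])

theorem eta_comp_eta {θ θ' : R1 → R1} (hθ : ∀ r, θ (θ' r) = r) {φ ψ : HA1 →+* HA1}
    (hr : ∀ r, φ (algebraMap R1 HA1 r) = algebraMap R1 HA1 (θ r))
    (hT : φ T = Ti) (hX : φ X = Xi) (hY : φ Y = T * Yi * Ti)
    (kr : ∀ r, ψ (algebraMap R1 HA1 r) = algebraMap R1 HA1 (θ' r))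
    (kT : ψ T = Ti) (kX : ψ X = Xi) (kY : ψ Y = T * Yi * Ti) :
    φ.comp ψ = RingHom.id HA1 := by
  have hTi : φ Ti = T := map_Ti hT T_mul_Ti
  have hXi : φ Xi = X := map_Xi hX X_mul_Xi
  have hYi : φ Yi = T * Y * Ti := map_Yi hY (by simp)
  refine ringHom_ext (fun r => ?_) ?_ ?_ ?_
  · rw [RingHom.comp_apply, kr, hr, hθ, RingHom.id_apply]
  · rw [RingHom.comp_apply, kT, hTi, RingHom.id_apply]
  · rw [RingHom.comp_apply, kX, hXi, RingHom.id_apply]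
  · rw [RingHom.comp_apply, kY, map_mul, map_mul, hT, hYi, hTi, RingHom.id_apply]
    simp

theorem existsUnique_eta {θ : R1 ≃+* R1} (hq : θ R1.q4 = R1.q4i) (ht : θ R1.t2 = R1.t2i) :
    ∃! η : HA1 ≃+* HA1, EtaA1 θ η := by
  obtain ⟨φ, hr, hT, hX, hY⟩ := exists_eta hq ht
  obtain ⟨ψ, kr, kT, kX, kY⟩ := exists_eta (R1.symm_q4 hq) (R1.symm_t2 ht)
  refine ⟨RingEquiv.ofRingHom φ ψ
    (eta_comp_eta θ.apply_symm_apply hr hT hX hY kr kT kX kY)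
    (eta_comp_eta θ.symm_apply_apply kr kT kX kY hr hT hX hY), ⟨hr, hX, hT, hY⟩, ?_⟩
  rintro η ⟨lr, lX, lT, lY⟩
  exact RingEquiv.toRingHom_injective <|
    ringHom_ext (fun r => (lr r).trans (hr r).symm) (lT.trans hT.symm) (lX.trans hX.symm)
      (lY.trans hY.symm)

end HA1


namespace H2

theorem isHecke_U0 : IsHecke U0 := by
  simpa [U0, IsHecke] using RingQuot.mkAlgHom_rel R1 H2Rel.heckeU0

theorem isHecke_U1 : IsHecke U1 := by
  simpa [U1, IsHecke] using RingQuot.mkAlgHom_rel R1 H2Rel.heckeU1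

@[simp] theorem V0_mul_V0 : V0 * V0 = 1 := by
  simpa [V0] using RingQuot.mkAlgHom_rel R1 H2Rel.v0sq

@[simp] theorem V1_mul_V1 : V1 * V1 = 1 := by
  simpa [V1] using RingQuot.mkAlgHom_rel R1 H2Rel.v1sq

theorem unit : algebraMap R1 H2 R1.q2 * V1 * V0 * U0 * U1 = 1 := by
  simpa [U0, U1, V0, V1] using RingQuot.mkAlgHom_rel R1 H2Rel.unit

theorem U0_mul_U0i : U0 * U0i = 1 := isHecke_U0.mul_inv

theorem U0i_mul_U0 : U0i * U0 = 1 := isHecke_U0.inv_mul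

@[simp] theorem U1_mul_U1i : U1 * U1i = 1 := isHecke_U1.mul_inv

@[simp] theorem U1i_mul_U1 : U1i * U1 = 1 := isHecke_U1.inv_mul

@[simp] theorem V0_mul_V0_mul (z : H2) : V0 * (V0 * z) = z := by
  rw [← mul_assoc, V0_mul_V0, one_mul]

@[simp] theorem V1_mul_V1_mul (z : H2) : V1 * (V1 * z) = z := by
  rw [← mul_assoc, V1_mul_V1, one_mul]

@[simp] theorem U1_mul_U1i_mul (z : H2) : U1 * (U1i * z) = z := by
  rw [← mul_assoc, U1_mul_U1i, one_mul]

@[simp] theorem U1i_mul_U1_mul (z : H2) : U1i * (U1 * z) = z := by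
  rw [← mul_assoc, U1i_mul_U1, one_mul]

theorem U0_eq : U0 = R1.q2i • (V0 * (V1 * U1i)) := by
  have h := congrArg (fun z => R1.q2i • (V0 * (V1 * (z * U1i)))) unit
  simpa [← Algebra.smul_def, smul_smul, mul_assoc, R1.q2_eq, R1.q2i_eq] using h

theorem U0i_eq : U0i = R1.q2 • (U1 * (V1 * V0)) :=
  left_inv_eq_right_inv U0i_mul_U0 (by simp [U0_eq, smul_smul, mul_assoc, R1.q2_eq, R1.q2i_eq])

/-- Universal property of `H^{(2)}` for homomorphisms that need not be linear over `R₁`. -/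
theorem exists_lift {A : Type*} [Ring A] (f : R1 →+* A) (hf : ∀ r a, f r * a = a * f r)
    {u0 u1 v0 v1 : A} (hecke0 : (u0 - f R1.t2) * (u0 + f R1.t2i) = 0)
    (hecke1 : (u1 - f R1.t2) * (u1 + f R1.t2i) = 0) (v0sq : v0 * v0 = 1) (v1sq : v1 * v1 = 1)
    (unit : f R1.q2 * v1 * v0 * u0 * u1 = 1) :
    ∃ φ : H2 →+* A, (∀ r, φ (algebraMap R1 H2 r) = f r) ∧
      φ U0 = u0 ∧ φ U1 = u1 ∧ φ V0 = v0 ∧ φ V1 = v1 := by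
  let _ : Algebra R1 A := f.toAlgebra' hf
  let g : Cgen → A := fun
    | .u0 => u0 | .u1 => u1 | .v0 => v0 | .v1 => v1
  have hg : ∀ ⦃a b⦄, H2Rel a b → FreeAlgebra.lift R1 g a = FreeAlgebra.lift R1 g b := by
    rintro _ _ (_ | _ | _ | _ | _) <;>
      simp only [map_mul, map_sub, map_add, map_one, map_zero, FreeAlgebra.lift_ι_apply,
        AlgHom.commutes] <;> assumption
  let φ : H2 →ₐ[R1] A := RingQuot.liftAlgHom R1 ⟨FreeAlgebra.lift R1 g, hg⟩
  have hφ (i : Cgen) : φ (RingQuot.mkAlgHom R1 H2Rel (FreeAlgebra.ι R1 i)) = g i := by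
    rw [RingQuot.liftAlgHom_mkAlgHom_apply, FreeAlgebra.lift_ι_apply]
  exact ⟨φ.toRingHom, φ.commutes, hφ .u0, hφ .u1, hφ .v0, hφ .v1⟩

theorem ringHom_ext {A : Type*} [Semiring A] {φ ψ : H2 →+* A}
    (hr : ∀ r, φ (algebraMap R1 H2 r) = ψ (algebraMap R1 H2 r))
    (hU0 : φ U0 = ψ U0) (hU1 : φ U1 = ψ U1) (hV0 : φ V0 = ψ V0) (hV1 : φ V1 = ψ V1) : φ = ψ := by
  refine RingHom.ext fun z => ?_
  obtain ⟨w, rfl⟩ := RingQuot.mkAlgHom_surjective R1 H2Rel z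
  induction w using FreeAlgebra.induction with
  | grade0 r => simpa using hr r
  | grade1 i => cases i <;> assumption
  | mul a b ha hb => simp only [map_mul, ha, hb]
  | add a b ha hb => simp only [map_add, ha, hb]

theorem algHom_ext {A : Type*} [Semiring A] [Algebra R1 A] {φ ψ : H2 →ₐ[R1] A}
    (hU0 : φ U0 = ψ U0) (hU1 : φ U1 = ψ U1) (hV0 : φ V0 = ψ V0) (hV1 : φ V1 = ψ V1) : φ = ψ :=
  AlgHom.coe_ringHom_injective <| ringHom_ext (fun r => by simp) hU0 hU1 hV0 hV1

theorem exists_algHom {A : Type*} [Ring A] [Algebra R1 A] {u0 u1 v0 v1 : A} (hecke0 : IsHecke u0)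
    (hecke1 : IsHecke u1) (v0sq : v0 * v0 = 1) (v1sq : v1 * v1 = 1)
    (unit : algebraMap R1 A R1.q2 * v1 * v0 * u0 * u1 = 1) :
    ∃ φ : H2 →ₐ[R1] A, φ U0 = u0 ∧ φ U1 = u1 ∧ φ V0 = v0 ∧ φ V1 = v1 := by
  obtain ⟨φ, hr, h⟩ :=
    exists_lift (A := A) (algebraMap R1 A) Algebra.commutes hecke0 hecke1 v0sq v1sq unit
  exact ⟨{ φ with commutes' := hr }, h⟩

theorem map_U0i {A F : Type*} [Semiring A] [FunLike F H2 A] [RingHomClass F H2 A] {φ : F} {u u' : A}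
    (h : φ U0 = u) (hu : u' * u = 1) : φ U0i = u' :=
  map_eq_of_inverses φ U0_mul_U0i h hu

theorem map_U1i {A F : Type*} [Semiring A] [FunLike F H2 A] [RingHomClass F H2 A] {φ : F} {u u' : A}
    (h : φ U1 = u) (hu : u' * u = 1) : φ U1i = u' :=
  map_eq_of_inverses φ U1_mul_U1i h hu

section

attribute [local simp] T_eq Ti_eq X_eq Xi_eq Y_eq Yi_eq c_eq_smul_one R1.q2_eq R1.q2i_eq smul_smul
  mul_assoc Algebra.algebraMap_eq_smul_one

theorem existsUnique_zeta : ∃! ζ : H2 →ₐ[R1] HA1, ZetaMap ζ := by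
  have h0 : IsHecke (Y * Y * Ti) := by
    rw [show Y * Y * Ti = Y * T * Yi by simp]
    exact isHecke_T.conj Y_mul_Yi Yi_mul_Y
  obtain ⟨φ, hU0, hU1, hV0, hV1⟩ : ∃ φ : H2 →ₐ[R1] HA1, φ U0 = Y * Y * Ti ∧ φ U1 = T ∧
      φ V0 = c R1.q4 * Y * Ti * Xi ∧ φ V1 = c R1.q4 * X * T * Y :=
    exists_algHom h0 isHecke_T (by simp) (by simp) (by simp)
  refine ⟨φ, ⟨hU1, hU0, hV0, hV1⟩, ?_⟩
  rintro ζ ⟨lU1, lU0, lV0, lV1⟩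
  exact algHom_ext (lU0.trans hU0.symm) (lU1.trans hU1.symm) (lV0.trans hV0.symm)
    (lV1.trans hV1.symm)

end

attribute [local simp] U0_eq U0i_eq R1.q2_eq R1.q2i_eq smul_smul mul_assoc
  Algebra.algebraMap_eq_smul_one

/-- The value of `τ₋` at `V₁` is `V₀`. -/
theorem tauMinus_V1_eq : algebraMap R1 H2 R1.q2i * V1i * (U1i * U0i) = V0 := by
  simp [V1i]

theorem existsUnique_tauMinus : ∃! τm : H2 ≃ₐ[R1] H2, TauMinusH2 τm := by
  obtain ⟨φ, hU0, hU1, hV0, hV1⟩ : ∃ φ : H2 →ₐ[R1] H2, φ U0 = U0 ∧ φ U1 = U1 ∧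
      φ V0 = V0 * V1 * V0 ∧ φ V1 = V0 :=
    exists_algHom isHecke_U0 isHecke_U1 (by simp) (by simp) (by simp)
  obtain ⟨ψ, kU0, kU1, kV0, kV1⟩ : ∃ ψ : H2 →ₐ[R1] H2, ψ U0 = U0 ∧ ψ U1 = U1 ∧
      ψ V0 = V1 ∧ ψ V1 = V1 * V0 * V1 :=
    exists_algHom isHecke_U0 isHecke_U1 (by simp) (by simp) (by simp)
  refine ⟨AlgEquiv.ofAlgHom φ ψ (algHom_ext ?_ ?_ ?_ ?_) (algHom_ext ?_ ?_ ?_ ?_),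
    ⟨hU0, hU1, hV1.trans tauMinus_V1_eq.symm, hV0⟩, ?_⟩
  · simp only [AlgHom.comp_apply, AlgHom.id_apply, hU0, kU0]
  · simp only [AlgHom.comp_apply, AlgHom.id_apply, hU1, kU1]
  · simp only [AlgHom.comp_apply, AlgHom.id_apply, kV0, hV1]
  · simp only [AlgHom.comp_apply, AlgHom.id_apply, kV1, map_mul, hV0, hV1]
    simp
  · simp only [AlgHom.comp_apply, AlgHom.id_apply, hU0, kU0]
  · simp only [AlgHom.comp_apply, AlgHom.id_apply, hU1, kU1]
  · simp only [AlgHom.comp_apply, AlgHom.id_apply, hV0, map_mul, kV0, kV1]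
    simp
  · simp only [AlgHom.comp_apply, AlgHom.id_apply, kV0, hV1]
  · rintro τ ⟨lU0, lU1, lV1, lV0⟩
    exact AlgEquiv.coe_toAlgHom_injective <|
      algHom_ext (lU0.trans hU0.symm) (lU1.trans hU1.symm) (lV0.trans hV0.symm)
        (lV1.trans (tauMinus_V1_eq.trans hV1.symm))

theorem existsUnique_tauPlusSq : ∃! τp : H2 ≃ₐ[R1] H2, TauPlusSqH2 τp := by
  have hX : XX * (U1 * V1) = 1 := by simp [XX, V1i]
  have hX' : U1 * V1 * XX = 1 := by simp [XX, V1i]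
  obtain ⟨φ, hU0, hU1, hV0, hV1⟩ : ∃ φ : H2 →ₐ[R1] H2, φ U0 = XX * U0 * (U1 * V1) ∧ φ U1 = U1 ∧
      φ V0 = XX * V0 * (U1 * V1) ∧ φ V1 = V1 :=
    exists_algHom (isHecke_U0.conj hX hX') isHecke_U1 (by simp [XX, V1i]) (by simp)
      (by simp [XX, V1i])
  obtain ⟨ψ, kU0, kU1, kV0, kV1⟩ : ∃ ψ : H2 →ₐ[R1] H2, ψ U0 = U1 * V1 * U0 * XX ∧ ψ U1 = U1 ∧
      ψ V0 = U1 * V1 * V0 * XX ∧ ψ V1 = V1 :=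
    exists_algHom (isHecke_U0.conj hX' hX) isHecke_U1 (by simp [XX, V1i]) (by simp)
      (by simp [XX, V1i])
  have hXX : φ XX = XX := by rw [XX, V1i, map_mul, hV1, map_U1i hU1 U1i_mul_U1]
  have kXX : ψ XX = XX := by rw [XX, V1i, map_mul, kV1, map_U1i kU1 U1i_mul_U1]
  refine ⟨AlgEquiv.ofAlgHom φ ψ (algHom_ext ?_ ?_ ?_ ?_) (algHom_ext ?_ ?_ ?_ ?_),
    ⟨hU1, hV1, hU0, hV0⟩, ?_⟩
  · simp only [AlgHom.comp_apply, AlgHom.id_apply, kU0, map_mul, hU0, hU1, hV1, hXX]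
    simp [XX, V1i]
  · simp only [AlgHom.comp_apply, AlgHom.id_apply, hU1, kU1]
  · simp only [AlgHom.comp_apply, AlgHom.id_apply, kV0, map_mul, hV0, hU1, hV1, hXX]
    simp [XX, V1i]
  · simp only [AlgHom.comp_apply, AlgHom.id_apply, hV1, kV1]
  · simp only [AlgHom.comp_apply, AlgHom.id_apply, hU0, map_mul, kU0, kU1, kV1, kXX]
    simp [XX, V1i]
  · simp only [AlgHom.comp_apply, AlgHom.id_apply, hU1, kU1]
  · simp only [AlgHom.comp_apply, AlgHom.id_apply, hV0, map_mul, kV0, kU1, kV1, kXX]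
    simp [XX, V1i]
  · simp only [AlgHom.comp_apply, AlgHom.id_apply, hV1, kV1]
  · rintro τ ⟨lU1, lV1, lU0, lV0⟩
    exact AlgEquiv.coe_toAlgHom_injective <|
      algHom_ext (lU0.trans hU0.symm) (lU1.trans hU1.symm) (lV0.trans hV0.symm)
        (lV1.trans hV1.symm)

theorem exists_eta {θ : R1 ≃+* R1} (hq : θ R1.q4 = R1.q4i) (ht : θ R1.t2 = R1.t2i) :
    ∃ φ : H2 →+* H2, (∀ r, φ (algebraMap R1 H2 r) = algebraMap R1 H2 (θ r)) ∧
      φ U0 = U0i ∧ φ U1 = U1i ∧ φ V0 = U0i * V0 * U0 ∧ φ V1 = U1 * V1i * U1i :=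
  exists_lift (u0 := U0i) (u1 := U1i) (v0 := U0i * V0 * U0) (v1 := U1 * V1i * U1i)
    ((algebraMap R1 H2).comp θ) (fun r => Algebra.commutes (θ r))
    (by simpa [-U0_eq, -U0i_eq, -Algebra.algebraMap_eq_smul_one, ht, R1.map_t2i ht]
      using isHecke_U0.inv U0_mul_U0i)
    (by simpa [-Algebra.algebraMap_eq_smul_one, ht, R1.map_t2i ht]
      using isHecke_U1.inv U1_mul_U1i)
    (by simp) (by simp [V1i]) (by simp [V1i, hq])

theorem eta_comp_eta {θ θ' : R1 → R1} (hθ : ∀ r, θ (θ' r) = r) {φ ψ : H2 →+* H2}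
    (hr : ∀ r, φ (algebraMap R1 H2 r) = algebraMap R1 H2 (θ r))
    (hU0 : φ U0 = U0i) (hU1 : φ U1 = U1i) (hV0 : φ V0 = U0i * V0 * U0)
    (hV1 : φ V1 = U1 * V1i * U1i)
    (kr : ∀ r, ψ (algebraMap R1 H2 r) = algebraMap R1 H2 (θ' r))
    (kU0 : ψ U0 = U0i) (kU1 : ψ U1 = U1i) (kV0 : ψ V0 = U0i * V0 * U0)
    (kV1 : ψ V1 = U1 * V1i * U1i) :
    φ.comp ψ = RingHom.id H2 := by
  have hU0i : φ U0i = U0 := map_U0i hU0 U0_mul_U0i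
  have hU1i : φ U1i = U1 := map_U1i hU1 U1_mul_U1i
  refine ringHom_ext (fun r => ?_) ?_ ?_ ?_ ?_
  · rw [RingHom.comp_apply, kr, hr, hθ, RingHom.id_apply]
  · rw [RingHom.comp_apply, kU0, hU0i, RingHom.id_apply]
  · rw [RingHom.comp_apply, kU1, hU1i, RingHom.id_apply]
  · rw [RingHom.comp_apply, kV0, map_mul, map_mul, hU0i, hV0, hU0, RingHom.id_apply]
    simp
  · rw [RingHom.comp_apply, kV1, V1i, map_mul, map_mul, hU1, hV1, hU1i, RingHom.id_apply]
    simp [V1i]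

theorem existsUnique_eta {θ : R1 ≃+* R1} (hq : θ R1.q4 = R1.q4i) (ht : θ R1.t2 = R1.t2i) :
    ∃! η : H2 ≃+* H2, EtaH2 θ η := by
  obtain ⟨φ, hr, hU0, hU1, hV0, hV1⟩ := exists_eta hq ht
  obtain ⟨ψ, kr, kU0, kU1, kV0, kV1⟩ := exists_eta (R1.symm_q4 hq) (R1.symm_t2 ht)
  refine ⟨RingEquiv.ofRingHom φ ψ
    (eta_comp_eta θ.apply_symm_apply hr hU0 hU1 hV0 hV1 kr kU0 kU1 kV0 kV1)
    (eta_comp_eta θ.symm_apply_apply kr kU0 kU1 kV0 kV1 hr hU0 hU1 hV0 hV1),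
    ⟨hr, hU1, hU0, hV1, hV0⟩, ?_⟩
  rintro η ⟨lr, lU1, lU0, lV1, lV0⟩
  exact RingEquiv.toRingHom_injective <|
    ringHom_ext (fun r => (lr r).trans (hr r).symm) (lU0.trans hU0.symm) (lU1.trans hU1.symm)
      (lV0.trans hV0.symm) (lV1.trans hV1.symm)

end H2

section Intertwining

attribute [local simp] T_eq Ti_eq X_eq Xi_eq Y_eq Yi_eq c_eq_smul_one R1.q2_eq R1.q2i_eq smul_smul
  mul_assoc Algebra.algebraMap_eq_smul_one

variable {ζ : H2 →ₐ[R1] HA1} {τm : HA1 ≃ₐ[R1] HA1}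

theorem ZetaMap.map_U1i (hζ : ZetaMap ζ) : ζ H2.U1i = Ti :=
  H2.map_U1i hζ.1 Ti_mul_T

theorem ZetaMap.map_U0i (hζ : ZetaMap ζ) : ζ H2.U0i = T * Yi * Yi :=
  H2.map_U0i hζ.2.1 (by simp)

theorem TauMinusA1.map_Xi (hτ : TauMinusA1 τm) : τm Xi = c R1.q4i * Xi * Yi :=
  HA1.map_Xi hτ.2.2 (by simp)

theorem TauMinusA1.map_Ti (hτ : TauMinusA1 τm) : τm Ti = Ti :=
  HA1.map_Ti hτ.2.1 Ti_mul_T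

theorem TauMinusA1.map_zeta_U0 (hζ : ZetaMap ζ) (hτ : TauMinusA1 τm) :
    τm (ζ H2.U0) = Y * T * Yi := by
  rw [hζ.2.1, map_mul, map_mul, hτ.1, hτ.map_Ti]
  simp

theorem TauMinusA1.map_zeta_V0 (hζ : ZetaMap ζ) (hτ : TauMinusA1 τm) :
    τm (ζ H2.V0) = Y * X * T * Yi := by
  rw [hζ.2.2.1]
  simp only [c, map_mul, AlgEquiv.commutes, hτ.1, hτ.map_Ti, hτ.map_Xi]
  simp

theorem TauMinusA1.map_zeta_V1 (hζ : ZetaMap ζ) (hτ : TauMinusA1 τm) :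
    τm (ζ H2.V1) = X * T := by
  rw [hζ.2.2.2]
  simp only [c, map_mul, AlgEquiv.commutes, hτ.1, hτ.2.1, hτ.2.2]
  simp

theorem zeta_comp_tauPlusSq {τp : HA1 ≃ₐ[R1] HA1} {τp2 : H2 ≃ₐ[R1] H2} (hζ : ZetaMap ζ)
    (hp : TauPlusA1 τp) (hm : TauMinusA1 τm) (hp2 : TauPlusSqH2 τp2) (x : H2) :
    ζ (τp2 x) = τm.symm (τp (τm (ζ x))) := by
  rw [AlgEquiv.eq_symm_apply]
  have hU1 : τm (ζ H2.U1) = T := by rw [hζ.1, hm.2.1]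
  have hU1i : τm (ζ H2.U1i) = Ti := by rw [hζ.map_U1i, hm.map_Ti]
  have hU0 := hm.map_zeta_U0 hζ
  have hV0 := hm.map_zeta_V0 hζ
  have hV1 := hm.map_zeta_V1 hζ
  have hYi : τp Yi = c R1.q4 * Yi * Xi := map_Yi hp.2.2 (by simp)
  obtain ⟨pX, pT, pY⟩ := hp
  obtain ⟨lU1, lV1, lU0, lV0⟩ := hp2
  suffices h : ((τm : HA1 →ₐ[R1] HA1).comp ζ).comp (τp2 : H2 →ₐ[R1] H2) =
      (τp : HA1 →ₐ[R1] HA1).comp ((τm : HA1 →ₐ[R1] HA1).comp ζ) from DFunLike.congr_fun h x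
  apply H2.algHom_ext <;>
    simp only [AlgHom.comp_apply, AlgEquiv.coe_toAlgHom, lU1, lV1, lU0, lV0, H2.XX,
      H2.V1i, map_mul, hU1, hU1i, hU0, hV0, hV1, pX, pT, pY, hYi] <;>
    simp

theorem zeta_comp_tauMinus {τm2 : H2 ≃ₐ[R1] H2} (hζ : ZetaMap ζ) (hm : TauMinusA1 τm)
    (hm2 : TauMinusH2 τm2) (x : H2) : ζ (τm2 x) = τm (τm (ζ x)) := by
  have hU1 : τm (ζ H2.U1) = T := by rw [hζ.1, hm.2.1]
  have hU0 := hm.map_zeta_U0 hζ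
  have hV0 := hm.map_zeta_V0 hζ
  have hV1 := hm.map_zeta_V1 hζ
  have hYi : τm Yi = Yi := map_Yi hm.1 Yi_mul_Y
  obtain ⟨mY, mT, mX⟩ := hm
  obtain ⟨zU1, zU0, zV0, zV1⟩ := hζ
  obtain ⟨lU0, lU1, lV1, lV0⟩ := hm2
  rw [H2.tauMinus_V1_eq] at lV1
  suffices h : ζ.comp (τm2 : H2 →ₐ[R1] H2) =
      (τm : HA1 →ₐ[R1] HA1).comp ((τm : HA1 →ₐ[R1] HA1).comp ζ) from DFunLike.congr_fun h x
  apply H2.algHom_ext <;>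
    simp only [AlgHom.comp_apply, AlgEquiv.coe_toAlgHom, lU1, lV1, lU0, lV0,
      map_mul, hU1, hU0, hV0, hV1, mX, mT, mY, hYi] <;>
    simp [zU1, zU0, zV0, zV1]

theorem zeta_comp_eta {θ : R1 ≃+* R1} {η : HA1 ≃+* HA1} {η2 : H2 ≃+* H2} (hζ : ZetaMap ζ)
    (hm : TauMinusA1 τm) (hη : EtaA1 θ η) (hη2 : EtaH2 θ η2) (x : H2) :
    ζ (η2 x) = τm.symm (η (τm (ζ x))) := by
  rw [AlgEquiv.eq_symm_apply]
  have hU1 : τm (ζ H2.U1) = T := by rw [hζ.1, hm.2.1]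
  have hU1i : τm (ζ H2.U1i) = Ti := by rw [hζ.map_U1i, hm.map_Ti]
  have hU0 := hm.map_zeta_U0 hζ
  have hU0i : τm (ζ H2.U0i) = Y * Ti * Yi :=
    map_eq_of_inverses τm (by rw [← map_mul, H2.U0_mul_U0i, map_one]) hU0 (by simp)
  have hV0 := hm.map_zeta_V0 hζ
  have hV1 := hm.map_zeta_V1 hζ
  obtain ⟨er, eX, eT, eY⟩ := hη
  have eYi : η Yi = T * Y * Ti := map_Yi eY (by simp)
  obtain ⟨lr, lU1, lU0, lV1, lV0⟩ := hη2
  suffices h : ((τm : HA1 →ₐ[R1] HA1).comp ζ : H2 →+* HA1).comp (η2 : H2 →+* H2) =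
      (η : HA1 →+* HA1).comp ((τm : HA1 →ₐ[R1] HA1).comp ζ) from DFunLike.congr_fun h x
  apply H2.ringHom_ext
  · intro r
    simp only [RingHom.comp_apply, RingHom.coe_coe, lr, er, AlgHom.commutes]
  all_goals
    simp only [RingHom.comp_apply, RingHom.coe_coe, AlgHom.comp_apply, AlgEquiv.coe_toAlgHom,
      lU1, lV1, lU0, lV0, H2.V1i, map_mul, hU1, hU1i, hU0, hU0i, hV0, hV1, eX, eT, eY, eYi]
    try simp

end Intertwining

/-- existence (and uniqueness) of the maps `ζ`, `τ₊`, `τ₋`, `η` (on `H^{A₁}`),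
`τ₋`, `τ₊²`, `η` (on `H^{(2)}`), and the intertwining identities
`ζ ∘ τ₊² = (τ₋⁻¹ ∘ τ₊ ∘ τ₋) ∘ ζ`, `ζ ∘ τ₋ = τ₋² ∘ ζ`, `ζ ∘ η = (τ₋⁻¹ ∘ η ∘ τ₋) ∘ ζ`. -/
theorem statement4 :
    (∃ θ : R1 ≃+* R1, θ R1.q4 = R1.q4i ∧ θ R1.t2 = R1.t2i) ∧
    (∃! τp : HA1 ≃ₐ[R1] HA1, TauPlusA1 τp) ∧
    (∃! τm : HA1 ≃ₐ[R1] HA1, TauMinusA1 τm) ∧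
    (∀ θ : R1 ≃+* R1, θ R1.q4 = R1.q4i → θ R1.t2 = R1.t2i →
      ∃! η : HA1 ≃+* HA1, EtaA1 θ η) ∧
    (∃! ζ : H2 →ₐ[R1] HA1, ZetaMap ζ) ∧
    (∃! τm2 : H2 ≃ₐ[R1] H2, TauMinusH2 τm2) ∧
    (∃! τp2 : H2 ≃ₐ[R1] H2, TauPlusSqH2 τp2) ∧
    (∀ θ : R1 ≃+* R1, θ R1.q4 = R1.q4i → θ R1.t2 = R1.t2i →
      ∃! η2 : H2 ≃+* H2, EtaH2 θ η2) ∧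
    (∀ (ζ : H2 →ₐ[R1] HA1) (τp τm : HA1 ≃ₐ[R1] HA1) (τp2 : H2 ≃ₐ[R1] H2),
      ZetaMap ζ → TauPlusA1 τp → TauMinusA1 τm → TauPlusSqH2 τp2 →
      ∀ x : H2, ζ (τp2 x) = τm.symm (τp (τm (ζ x)))) ∧
    (∀ (ζ : H2 →ₐ[R1] HA1) (τm : HA1 ≃ₐ[R1] HA1) (τm2 : H2 ≃ₐ[R1] H2),
      ZetaMap ζ → TauMinusA1 τm → TauMinusH2 τm2 →
      ∀ x : H2, ζ (τm2 x) = τm (τm (ζ x))) ∧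
    (∀ (θ : R1 ≃+* R1), θ R1.q4 = R1.q4i → θ R1.t2 = R1.t2i →
      ∀ (ζ : H2 →ₐ[R1] HA1) (τm : HA1 ≃ₐ[R1] HA1) (η : HA1 ≃+* HA1) (η2 : H2 ≃+* H2),
      ZetaMap ζ → TauMinusA1 τm → EtaA1 θ η → EtaH2 θ η2 →
      ∀ x : H2, ζ (η2 x) = τm.symm (η (τm (ζ x)))) := by
  exact ⟨R1.exists_inversion, existsUnique_tauPlus, existsUnique_tauMinus,
    fun _ hq ht => existsUnique_eta hq ht, H2.existsUnique_zeta, H2.existsUnique_tauMinus,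
    H2.existsUnique_tauPlusSq, fun _ hq ht => H2.existsUnique_eta hq ht,
    fun _ _ _ _ => zeta_comp_tauPlusSq, fun _ _ _ => zeta_comp_tauMinus,
    fun _ _ _ _ _ _ _ => zeta_comp_eta⟩

end Statement4
end
end

section
/- PBW theorem for the C∨C₁ DAHA: the family {𝕏^n · V₁^ε · 𝕐^m : n, m ∈ ℤ, ε ∈ {0, 1}} is a basis of H as an R-module; that is, every element of H can be written uniquely as a finite R-linear combination Σ C_{n,ε,m} · 𝕏^n · V₁^ε · 𝕐^m. -/
noncomputable section

/-- The base ring `R = ℤ[q^{±1/4}, u₀^{±1/2}, u₁^{±1/2}, v₀^{±1/2}, v₁^{±1/2}]`: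
the group algebra over `ℤ` of the free abelian group on five generators, where the
exponents record the variables `(q^{1/4}, u₀^{1/2}, u₁^{1/2}, v₀^{1/2}, v₁^{1/2})`. -/
abbrev R5 : Type := AddMonoidAlgebra ℤ (ℤ × ℤ × ℤ × ℤ × ℤ)

namespace R5
/-- `q^{1/4}` -/
def q4 : R5 := AddMonoidAlgebra.single (1, 0, 0, 0, 0) 1
/-- `q^{-1/4}` -/
def q4i : R5 := AddMonoidAlgebra.single (-1, 0, 0, 0, 0) 1
/-- `u₀^{1/2}` -/
def u0h : R5 := AddMonoidAlgebra.single (0, 1, 0, 0, 0) 1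
def u0hi : R5 := AddMonoidAlgebra.single (0, -1, 0, 0, 0) 1
/-- `u₁^{1/2}` -/
def u1h : R5 := AddMonoidAlgebra.single (0, 0, 1, 0, 0) 1
def u1hi : R5 := AddMonoidAlgebra.single (0, 0, -1, 0, 0) 1
/-- `v₀^{1/2}` -/
def v0h : R5 := AddMonoidAlgebra.single (0, 0, 0, 1, 0) 1
def v0hi : R5 := AddMonoidAlgebra.single (0, 0, 0, -1, 0) 1
/-- `v₁^{1/2}` -/
def v1h : R5 := AddMonoidAlgebra.single (0, 0, 0, 0, 1) 1
def v1hi : R5 := AddMonoidAlgebra.single (0, 0, 0, 0, -1) 1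
end R5

open FreeAlgebra in
/-- The defining relations of the DAHA of type `C∨C₁`:
`(U_i − u_i^{1/2})(U_i + u_i^{−1/2}) = 0`, `(V_i − v_i^{1/2})(V_i + v_i^{−1/2}) = 0`
for `i = 0, 1`, and `q^{1/4}·V₁·V₀·U₀·U₁ = 1`. -/
inductive Crel : FreeAlgebra R5 Cgen → FreeAlgebra R5 Cgen → Prop
  | heckeU0 : Crel ((ι R5 Cgen.u0 - algebraMap R5 _ R5.u0h) *
      (ι R5 Cgen.u0 + algebraMap R5 _ R5.u0hi)) 0
  | heckeU1 : Crel ((ι R5 Cgen.u1 - algebraMap R5 _ R5.u1h) *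
      (ι R5 Cgen.u1 + algebraMap R5 _ R5.u1hi)) 0
  | heckeV0 : Crel ((ι R5 Cgen.v0 - algebraMap R5 _ R5.v0h) *
      (ι R5 Cgen.v0 + algebraMap R5 _ R5.v0hi)) 0
  | heckeV1 : Crel ((ι R5 Cgen.v1 - algebraMap R5 _ R5.v1h) *
      (ι R5 Cgen.v1 + algebraMap R5 _ R5.v1hi)) 0
  | unit : Crel (algebraMap R5 _ R5.q4 * ι R5 Cgen.v1 * ι R5 Cgen.v0 *
      ι R5 Cgen.u0 * ι R5 Cgen.u1) 1

/-- The DAHA of type `C∨C₁`. -/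
abbrev H : Type := RingQuot Crel

namespace H

def U0 : H := RingQuot.mkAlgHom R5 Crel (FreeAlgebra.ι R5 Cgen.u0)
def U1 : H := RingQuot.mkAlgHom R5 Crel (FreeAlgebra.ι R5 Cgen.u1)
def V0 : H := RingQuot.mkAlgHom R5 Crel (FreeAlgebra.ι R5 Cgen.v0)
def V1 : H := RingQuot.mkAlgHom R5 Crel (FreeAlgebra.ι R5 Cgen.v1)

/-- image of a base-ring element in `H` -/
def c (r : R5) : H := algebraMap R5 H r

/-- `U₀⁻¹ = U₀ − u₀^{1/2} + u₀^{−1/2}` -/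
def U0i : H := U0 - c R5.u0h + c R5.u0hi
/-- `U₁⁻¹ = U₁ − u₁^{1/2} + u₁^{−1/2}` -/
def U1i : H := U1 - c R5.u1h + c R5.u1hi
/-- `V₀⁻¹ = V₀ − v₀^{1/2} + v₀^{−1/2}` -/
def V0i : H := V0 - c R5.v0h + c R5.v0hi
/-- `V₁⁻¹ = V₁ − v₁^{1/2} + v₁^{−1/2}` -/
def V1i : H := V1 - c R5.v1h + c R5.v1hi
/-- `𝕏 = V₁⁻¹·U₁⁻¹` -/
def XX : H := V1i * U1i
/-- `𝕏⁻¹ = U₁·V₁` -/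
def XXi : H := U1 * V1
/-- `𝕐 = U₀·U₁` -/
def YY : H := U0 * U1
/-- `𝕐⁻¹ = U₁⁻¹·U₀⁻¹` -/
def YYi : H := U1i * U0i

end H

open H

/-- `φ : H → H'` is semilinear over `θ : R → R` -/
def Semilin (θ : R5 ≃+* R5) (f : H → H) : Prop :=
  ∀ r : R5, f (algebraMap R5 H r) = algebraMap R5 H (θ r)

namespace H

/-- integer powers of `𝕏` (using `𝕏⁻¹ = U₁·V₁` for negative exponents) -/
def xpow (n : ℤ) : H := if 0 ≤ n then XX ^ n.toNat else XXi ^ (-n).toNat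

/-- integer powers of `𝕐` (using `𝕐⁻¹ = U₁⁻¹·U₀⁻¹` for negative exponents) -/
def ypow (m : ℤ) : H := if 0 ≤ m then YY ^ m.toNat else YYi ^ (-m).toNat

/-- the PBW family `𝕏^n · V₁^ε · 𝕐^m`, indexed by `(n, ε, m) ∈ ℤ × {0,1} × ℤ` -/
def pbw : ℤ × Bool × ℤ → H :=
  fun p => xpow p.1 * (if p.2.1 then V1 else 1) * ypow p.2.2

end H

open LaurentPolynomial in
/-- A reflection `s` of the Laurent polynomial ring together with an `s`-twisted derivation `D`. -/
theorem exists_twistedDerivation {K : Type*} [CommRing K] (κ : Kˣ) (β v : K) :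
    ∃ (s : K[T;T⁻¹] →ₐ[K] K[T;T⁻¹]) (D : K[T;T⁻¹] →ₗ[K] K[T;T⁻¹]),
      s (T 1) = (κ : K) • T (-1) ∧ D (T 1) = β • 1 + v • T 1 ∧
      ∀ f g, D (f * g) = s f * D g + D f * g := by
  have hT : (T 1 * T (-1) : K[T;T⁻¹]) = 1 := by rw [← T_add]; simp
  have hT' : (T (-1) * T 1 : K[T;T⁻¹]) = 1 := by rw [← T_add]; simp
  have hκ : C (κ : K) * C ((κ⁻¹ : Kˣ) : K) = 1 := by rw [← map_mul]; simp
  let z : K[T;T⁻¹]ˣ :=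
    { val := C (κ : K) * T (-1)
      inv := C ((κ⁻¹ : Kˣ) : K) * T 1
      val_inv := by linear_combination hκ + C (κ : K) * C ((κ⁻¹ : Kˣ) : K) * hT
      inv_val := by linear_combination hκ + C (κ : K) * C ((κ⁻¹ : Kˣ) : K) * hT }
  let d : K[T;T⁻¹] := C β + C v * T 1
  let N : (Matrix (Fin 2) (Fin 2) K[T;T⁻¹])ˣ :=
    { val := !![z, d; 0, T 1]
      inv := !![z.inv, -(z.inv * d * T (-1)); 0, T (-1)]
      val_inv := by
        ext i j : 1
        fin_cases i <;> fin_cases j <;> simp [Matrix.mul_apply, hT, mul_assoc]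
      inv_val := by
        ext i j : 1
        fin_cases i <;> fin_cases j <;> simp [Matrix.mul_apply, hT'] }
  let s : K[T;T⁻¹] →ₐ[K] K[T;T⁻¹] :=
    AddMonoidAlgebra.lift K _ ℤ ((Units.coeHom _).comp (zpowersHom _ z))
  let Ψ : K[T;T⁻¹] →ₐ[K] Matrix (Fin 2) (Fin 2) K[T;T⁻¹] :=
    AddMonoidAlgebra.lift K _ ℤ ((Units.coeHom _).comp (zpowersHom _ N))
  have hs (n : ℤ) : s (T n) = ((z ^ n : K[T;T⁻¹]ˣ) : K[T;T⁻¹]) := by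
    rw [T, AddMonoidAlgebra.lift_single, one_smul]; rfl
  have hΨ (n : ℤ) : Ψ (T n) = ((N ^ n : (Matrix (Fin 2) (Fin 2) K[T;T⁻¹])ˣ) :
      Matrix (Fin 2) (Fin 2) K[T;T⁻¹]) := by
    rw [T, AddMonoidAlgebra.lift_single, one_smul]; rfl
  have key (f : K[T;T⁻¹]) : Ψ f 0 0 = s f ∧ Ψ f 1 0 = 0 ∧ Ψ f 1 1 = f := by
    have step (f g : K[T;T⁻¹]) (hf : Ψ f 0 0 = s f ∧ Ψ f 1 0 = 0 ∧ Ψ f 1 1 = f)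
        (hg : Ψ g 0 0 = s g ∧ Ψ g 1 0 = 0 ∧ Ψ g 1 1 = g) :
        Ψ (f * g) 0 0 = s (f * g) ∧ Ψ (f * g) 1 0 = 0 ∧ Ψ (f * g) 1 1 = f * g := by
      simp [Matrix.mul_apply, hf, hg]
    have h1 : Ψ (T 1) 0 0 = s (T 1) ∧ Ψ (T 1) 1 0 = 0 ∧ Ψ (T 1) 1 1 = T 1 := by
      rw [hΨ, hs]; simp [N]
    have h2 : Ψ (T (-1)) 0 0 = s (T (-1)) ∧ Ψ (T (-1)) 1 0 = 0 ∧ Ψ (T (-1)) 1 1 = T (-1) := by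
      rw [hΨ, hs, zpow_neg_one, zpow_neg_one]
      exact ⟨rfl, rfl, rfl⟩
    have hC (a : K) : Ψ (C a) 0 0 = s (C a) ∧ Ψ (C a) 1 0 = 0 ∧ Ψ (C a) 1 1 = C a := by
      rw [C_eq_algebraMap, AlgHom.commutes, AlgHom.commutes]
      simp [Matrix.algebraMap_matrix_apply]
    induction f using LaurentPolynomial.induction_on with
    | h_C a => exact hC a
    | h_add hp hq => simp [hp, hq]
    | h_C_mul_T n a h => rw [T_add, ← mul_assoc]; exact step _ _ h h1
    | h_C_mul_T_Z n a h => rw [sub_eq_add_neg, T_add, ← mul_assoc]; exact step _ _ h h2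
  refine ⟨s, (Matrix.entryLinearMap K _ 0 1).comp Ψ.toLinearMap, ?_, ?_, fun f g => ?_⟩
  · simp [hs, z, smul_eq_C_mul]
  · simp [hΨ, N, d, smul_eq_C_mul]
  · simp [Matrix.mul_apply, key]

open LaurentPolynomial in
/-- The twisted derivation of `exists_twistedDerivation` satisfies the identities which make
`a • s + D` a Hecke-type operator. -/
theorem exists_demazureLusztig {K : Type*} [CommRing K] (κ : Kˣ) (β v : K) :
    ∃ (s : K[T;T⁻¹] →ₐ[K] K[T;T⁻¹]) (D : K[T;T⁻¹] →ₗ[K] K[T;T⁻¹]),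
      s (T 1) = (κ : K) • T (-1) ∧ D (T 1) = β • 1 + v • T 1 ∧
      (∀ f g, D (f * g) = s f * D g + D f * g) ∧ (∀ f, s (s f) = f) ∧
      (∀ f, D (D f) = v • D f) ∧ ∀ f, s (D f) + D (s f) = v • (s f - f) := by
  obtain ⟨s, D, h1, h2, h3⟩ := exists_twistedDerivation κ β v
  have hT : (T 1 * T (-1) : K[T;T⁻¹]) = 1 := by rw [← T_add]; simp
  have hκ : C (κ : K) * C ((κ⁻¹ : Kˣ) : K) = 1 := by rw [← map_mul]; simp
  have hD1 : D 1 = 0 := by simpa using h3 1 1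
  have hsC (a : K) : s (C a) = C a := by rw [C_eq_algebraMap, AlgHom.commutes]
  have hDC (a : K) : D (C a) = 0 := by
    rw [← mul_one (C a), ← smul_eq_C_mul, map_smul, hD1, smul_zero]
  have hDm (a : K) (f) : D (C a * f) = C a * D f := by simp [← smul_eq_C_mul]
  have hsi : s (T (-1)) = C ((κ⁻¹ : Kˣ) : K) * T 1 := by
    have : s (T 1) * s (T (-1)) = 1 := by rw [← map_mul, hT, map_one]
    rw [h1, smul_eq_C_mul] at this
    linear_combination (C ((κ⁻¹ : Kˣ) : K) * T 1) * this - s (T (-1)) * hκ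
      - C ((κ⁻¹ : Kˣ) : K) * C (κ : K) * s (T (-1)) * hT
  rw [smul_eq_C_mul] at h1
  rw [smul_eq_C_mul, smul_eq_C_mul, mul_one] at h2
  have hDi : D (T (-1)) = - C ((κ⁻¹ : Kˣ) : K) * (C β + C v * T 1) := by
    have := h3 (T (-1)) (T 1)
    rw [mul_comm, hT, hD1, hsi, h2] at this
    linear_combination (-T (-1)) * this
      - (D (T (-1)) + C ((κ⁻¹ : Kˣ) : K) * (C β + C v * T 1)) * hT
  refine ⟨s, D, by rw [h1, smul_eq_C_mul], by simp [h2, smul_eq_C_mul], h3, ?_⟩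
  have key (f : K[T;T⁻¹]) : s (s f) = f ∧ D (D f) = C v * D f ∧
      s (D f) + D (s f) = C v * (s f - f) := by
    have step (f g : K[T;T⁻¹])
        (hf : s (s f) = f ∧ D (D f) = C v * D f ∧ s (D f) + D (s f) = C v * (s f - f))
        (hg : s (s g) = g ∧ D (D g) = C v * D g ∧ s (D g) + D (s g) = C v * (s g - g)) :
        s (s (f * g)) = f * g ∧ D (D (f * g)) = C v * D (f * g) ∧
          s (D (f * g)) + D (s (f * g)) = C v * (s (f * g) - f * g) := by
      obtain ⟨f1, f2, f3⟩ := hf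
      obtain ⟨g1, g2, g3⟩ := hg
      refine ⟨by simp [f1, g1], ?_, ?_⟩
      · simp only [h3, map_add, f1, f2, g2]
        linear_combination D g * f3
      · simp only [h3, map_add, map_mul, f1]
        linear_combination f * g3 + s g * f3
    have hT1 : s (s (T 1)) = T 1 ∧ D (D (T 1)) = C v * D (T 1) ∧
        s (D (T 1)) + D (s (T 1)) = C v * (s (T 1) - T 1) := by
      refine ⟨?_, ?_, ?_⟩
      · simp only [h1, map_mul, hsC, hsi]
        linear_combination T 1 * hκ
      · simp only [h2, map_add, hDC, hDm]; ring
      · simp only [h1, h2, map_add, map_mul, hsC, hDm, hDi]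
        linear_combination (- (C β + C v * T 1)) * hκ
    have hT2 : s (s (T (-1))) = T (-1) ∧ D (D (T (-1))) = C v * D (T (-1)) ∧
        s (D (T (-1))) + D (s (T (-1))) = C v * (s (T (-1)) - T (-1)) := by
      refine ⟨?_, ?_, ?_⟩
      · simp only [h1, map_mul, hsC, hsi]
        linear_combination T (-1) * hκ
      · simp only [hDi, neg_mul, map_neg, hDm, map_add, hDC, h2]; ring
      · simp only [hDi, hsi, neg_mul, map_neg, hDm, map_add, map_mul, hsC, h1, h2]
        linear_combination (- C v * T (-1)) * hκ
    have hC (a : K) : s (s (C a)) = C a ∧ D (D (C a)) = C v * D (C a) ∧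
        s (D (C a)) + D (s (C a)) = C v * (s (C a) - C a) := by
      simp [hsC, hDC]
    induction f using LaurentPolynomial.induction_on with
    | h_C a => exact hC a
    | h_add hp hq =>
      refine ⟨by simp [hp, hq], by simp [hp, hq, mul_add], ?_⟩
      simp only [map_add]
      linear_combination hp.2.2 + hq.2.2
    | h_C_mul_T n a h => rw [T_add, ← mul_assoc]; exact step _ _ h hT1
    | h_C_mul_T_Z n a h => rw [sub_eq_add_neg, T_add, ← mul_assoc]; exact step _ _ h hT2
  simp only [smul_eq_C_mul]
  exact ⟨fun f => (key f).1, fun f => (key f).2.1, fun f => (key f).2.2⟩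

open LaurentPolynomial in
/-- An operator on `K[T;T⁻¹]²` extending a given `2 × 2` matrix `(a b; c d)` that satisfies
`P² = vP + 1`, with a prescribed quadratic relation and a prescribed Bernstein cross relation with
multiplication by `T 1`. -/
theorem exists_heckeOperator {K : Type*} [CommRing K] (κ : Kˣ) (β v a b c d : K)
    (h11 : a * a + b * c = v * a + 1) (h12 : a * b + b * d = v * b)
    (h21 : c * a + d * c = v * c) (h22 : c * b + d * d = v * d + 1) :
    ∃ V : Module.End K (K[T;T⁻¹] × K[T;T⁻¹]), (∀ m, V (V m) = v • V m + m) ∧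
      (∀ m : K[T;T⁻¹] × K[T;T⁻¹], V ((T 1 : K[T;T⁻¹]) • m) =
        (κ : K) • ((T (-1) : K[T;T⁻¹]) • V m) + β • m + v • ((T 1 : K[T;T⁻¹]) • m)) ∧
      V (1, 0) = (C a, C c) ∧ V (0, 1) = (C b, C d) := by
  obtain ⟨s, D, h1, h2, h3, hs, hD, hsD⟩ := exists_demazureLusztig κ β v
  have hD1 : D 1 = 0 := by simpa using h3 1 1
  let V : Module.End K (K[T;T⁻¹] × K[T;T⁻¹]) :=
    { toFun m := (s (a • m.1 + b • m.2) + D m.1, s (c • m.1 + d • m.2) + D m.2)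
      map_add' m n := by ext1 <;> simp <;> module
      map_smul' r m := by ext1 <;> simp <;> module }
  have hV (m) : V m = (a • s m.1 + b • s m.2 + D m.1, c • s m.1 + d • s m.2 + D m.2) := by
    simp [V]
  have hDs (f) : D (s f) = v • (s f - f) - s (D f) := by rw [← hsD]; abel
  refine ⟨V, fun m => ?_, fun m => ?_, ?_, ?_⟩
  · simp only [hV, map_add, map_smul, hs, hD, hDs]
    simp only [smul_eq_C_mul]
    have e11 := congrArg C h11
    have e12 := congrArg C h12
    have e21 := congrArg C h21
    have e22 := congrArg C h22
    simp only [map_add, map_mul, map_one] at e11 e12 e21 e22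
    ext1
    · simp only [Prod.fst_add, Prod.smul_fst, smul_eq_C_mul]
      linear_combination m.1 * e11 + m.2 * e12
    · simp only [Prod.snd_add, Prod.smul_snd, smul_eq_C_mul]
      linear_combination m.1 * e21 + m.2 * e22
  · simp only [hV, Prod.smul_fst, Prod.smul_snd, smul_eq_mul, map_mul, h1, h3, h2]
    ext1 <;> simp [smul_eq_C_mul] <;> ring
  · simp [hV, hD1, smul_eq_C_mul]
  · simp [hV, hD1, smul_eq_C_mul]

open LaurentPolynomial in
/-- Operators `X`, `V₀`, `V₁` satisfying the Bernstein presentation of the `C∨C₁` DAHA, for which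
`(1, 0)` is an eigenvector of `V₁V₀`. -/
theorem exists_daha_operators {K : Type*} [CommRing K] (q y : Kˣ) (a₀ a₁ b₀ b₁ : K) :
    ∃ X Xi V₀ V₁ : Module.End K (K[T;T⁻¹] × K[T;T⁻¹]),
      (∀ m, X m = (T 1 : K[T;T⁻¹]) • m) ∧ X * Xi = 1 ∧ Xi * X = 1 ∧
      V₀ * V₀ = b₀ • V₀ + 1 ∧ V₁ * V₁ = b₁ • V₁ + 1 ∧
      V₀ * X = ((q * q : Kˣ) : K) • (Xi * V₀) + ((q : K) * a₀) • 1 + b₀ • X ∧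
      V₁ * Xi = X * V₁ + a₁ • 1 + b₁ • Xi ∧
      V₁ (1, 0) = (0, 1) ∧ V₁ (V₀ (1, 0)) = ((q⁻¹ * y⁻¹ : Kˣ) : K) • (1, 0) := by
  have hq : (q : K) * (q⁻¹ : Kˣ) = 1 := by simp
  have hy : (y : K) * (y⁻¹ : Kˣ) = 1 := by simp
  have hT : (T 1 * T (-1) : K[T;T⁻¹]) = 1 := by rw [← T_add]; simp
  have hT' : (T (-1) * T 1 : K[T;T⁻¹]) = 1 := by rw [← T_add]; simp
  let r : K := (q⁻¹ : Kˣ) * (y⁻¹ : Kˣ)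
  have hr : r * (q * y) = 1 := by simp only [r]; linear_combination hy + (y : K) * (y⁻¹ : Kˣ) * hq
  obtain ⟨V₀, hV₀, hX₀, he₀, -⟩ := exists_heckeOperator (q * q) (q * a₀) b₀ (-(b₁ * r))
    (q * y - b₁ * b₁ * r - b₁ * b₀) r (b₁ * r + b₀)
    (by linear_combination hr) (by ring) (by ring) (by linear_combination hr)
  obtain ⟨W, hW, hXW, he1, he2⟩ := exists_heckeOperator 1 a₁ b₁ 0 1 1 b₁
    (by ring) (by ring) (by ring) (by ring)
  let X : Module.End K (K[T;T⁻¹] × K[T;T⁻¹]) :=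
    (LinearMap.lsmul K[T;T⁻¹] (K[T;T⁻¹] × K[T;T⁻¹]) (T 1)).restrictScalars K
  let Xi : Module.End K (K[T;T⁻¹] × K[T;T⁻¹]) :=
    (LinearMap.lsmul K[T;T⁻¹] (K[T;T⁻¹] × K[T;T⁻¹]) (T (-1))).restrictScalars K
  have hX (m) : X m = (T 1 : K[T;T⁻¹]) • m := rfl
  have hXi (m) : Xi m = (T (-1) : K[T;T⁻¹]) • m := rfl
  let J : Module.End K (K[T;T⁻¹] × K[T;T⁻¹]) :=
    LinearMap.prodMap (invert (R := K)).toLinearMap (invert (R := K)).toLinearMap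
  have hJ (m) : J m = (invert m.1, invert m.2) := rfl
  have hJJ (m) : J (J m) = m := by ext <;> simp [hJ]
  have hJT (n : ℤ) (m) : J ((T n : K[T;T⁻¹]) • m) = (T (-n) : K[T;T⁻¹]) • J m := by
    simp [hJ, Prod.smul_def]
  refine ⟨X, Xi, V₀, J * W * J, hX, ?_, ?_, ?_, ?_, ?_, ?_, ?_, ?_⟩
  · refine LinearMap.ext fun m => ?_
    simp only [Module.End.mul_apply, hX, hXi, smul_smul, hT, one_smul, Module.End.one_apply]
  · refine LinearMap.ext fun m => ?_
    simp only [Module.End.mul_apply, hX, hXi, smul_smul, hT', one_smul, Module.End.one_apply]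
  · refine LinearMap.ext fun m => ?_; exact hV₀ m
  · refine LinearMap.ext fun m => ?_; simp [Module.End.mul_apply, hJJ, hW]
  · refine LinearMap.ext fun m => ?_; exact hX₀ m
  · refine LinearMap.ext fun m => ?_
    simp [Module.End.mul_apply, hX, hXi, hJT, hXW, hJJ]
  · simp [Module.End.mul_apply, hJ, he1]
  · have hd : ((C (-(b₁ * r)), C r) : K[T;T⁻¹] × K[T;T⁻¹]) =
        (-(b₁ * r)) • (1, 0) + r • (0, 1) := by
      simp [smul_eq_C_mul]
    rw [he₀, hd]
    simp only [Module.End.mul_apply, map_add, map_smul]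
    have e1 : J (1, 0) = (1, 0) := by simp [hJ]
    have e2 : J (0, 1) = (0, 1) := by simp [hJ]
    have e3 : ((C 0, C 1) : K[T;T⁻¹] × K[T;T⁻¹]) = (0, 1) := by simp
    have e4 : ((C 1, C b₁) : K[T;T⁻¹] × K[T;T⁻¹]) = (1, 0) + b₁ • (0, 1) := by
      simp [smul_eq_C_mul]
    rw [e1, e2, he1, he2, e3, e4, map_add, map_smul, e1, e2]
    rw [Units.val_mul]
    module

theorem hecke_factor_eq_zero_iff {R B : Type*} [CommRing R] [Ring B] [Algebra R B] {a a' : R}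
    (h : a * a' = 1) (x : B) :
    (x - algebraMap R B a) * (x + algebraMap R B a') = 0 ↔ x * x = (a - a') • x + 1 := by
  have : (x - algebraMap R B a) * (x + algebraMap R B a') =
      x * x - ((a - a') • x + (a * a') • 1) := by
    simp only [Algebra.algebraMap_eq_smul_one, sub_mul, mul_add, mul_smul_comm, smul_mul_assoc,
      mul_one, one_mul]
    module
  rw [this, h, one_smul, sub_eq_zero]

/-- The defining relations of the `C∨C₁` DAHA, with the quadratic relations written as
`U² = aU + 1`. -/
structure DAHARelations {R B : Type*} [CommRing R] [Ring B] [Algebra R B] (q : Rˣ)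
    (a₀ a₁ b₀ b₁ : R) (U₀ U₁ V₀ V₁ : B) : Prop where
  sq_U₀ : U₀ * U₀ = a₀ • U₀ + 1
  sq_U₁ : U₁ * U₁ = a₁ • U₁ + 1
  sq_V₀ : V₀ * V₀ = b₀ • V₀ + 1
  sq_V₁ : V₁ * V₁ = b₁ • V₁ + 1
  prod_eq : (q : R) • (V₁ * V₀ * U₀ * U₁) = 1

/-- The unit with inverse `x - a` attached to a solution of `x² = ax + 1`. -/
def heckeUnit {R B : Type*} [CommRing R] [Ring B] [Algebra R B] {a : R} {x : B}
    (h : x * x = a • x + 1) : Bˣ where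
  val := x
  inv := x - a • 1
  val_inv := by rw [mul_sub, h, mul_smul_comm, mul_one]; abel
  inv_val := by rw [sub_mul, h, smul_mul_assoc, one_mul]; abel

namespace DAHARelations

variable {R B : Type*} [CommRing R] [Ring B] [Algebra R B] {q : Rˣ}
  {a₀ a₁ b₀ b₁ : R} {U₀ U₁ V₀ V₁ : B}

/-- The unit `𝕏 = V₁⁻¹U₁⁻¹`. -/
def x (h : DAHARelations q a₀ a₁ b₀ b₁ U₀ U₁ V₀ V₁) : Bˣ :=
  (heckeUnit h.sq_V₁)⁻¹ * (heckeUnit h.sq_U₁)⁻¹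

/-- The unit `𝕐 = U₀U₁`. -/
def y (h : DAHARelations q a₀ a₁ b₀ b₁ U₀ U₁ V₀ V₁) : Bˣ :=
  heckeUnit h.sq_U₀ * heckeUnit h.sq_U₁

/-- The family `𝕏ⁿ V₁^ε 𝕐ᵐ`. -/
def monomial (h : DAHARelations q a₀ a₁ b₀ b₁ U₀ U₁ V₀ V₁) (p : ℤ × Bool × ℤ) : B :=
  ((h.x ^ p.1 : Bˣ) : B) * (if p.2.1 then V₁ else 1) * ((h.y ^ p.2.2 : Bˣ) : B)

variable (h : DAHARelations q a₀ a₁ b₀ b₁ U₀ U₁ V₀ V₁)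

theorem x_mul_inv_U₀ : (q : R) • V₀ = (h.x : B) * (U₀ - a₀ • 1) := by
  have e0 : U₀ * (U₀ - a₀ • 1) = 1 := (heckeUnit h.sq_U₀).mul_inv
  have e1 : U₁ * (U₁ - a₁ • 1) = 1 := (heckeUnit h.sq_U₁).mul_inv
  have e2 : (V₁ - b₁ • 1) * V₁ = 1 := (heckeUnit h.sq_V₁).inv_mul
  have hx : (h.x : B) = (V₁ - b₁ • 1) * (U₁ - a₁ • 1) := rfl
  calc (q : R) • V₀ = (q : R) • (((V₁ - b₁ • 1) * V₁) * V₀ *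
          (U₀ * (U₁ * (U₁ - a₁ • 1)) * (U₀ - a₀ • 1))) := by
        rw [e1, mul_one, e0, e2, one_mul, mul_one]
    _ = (V₁ - b₁ • 1) * ((q : R) • (V₁ * V₀ * U₀ * U₁)) * ((U₁ - a₁ • 1) * (U₀ - a₀ • 1)) := by
        simp only [mul_smul_comm, smul_mul_assoc, mul_assoc]
    _ = _ := by rw [h.prod_eq, hx, mul_one, mul_assoc]

theorem U₀_eq : U₀ = (q : R) • ((h.x⁻¹ : Bˣ) * V₀) + a₀ • 1 := by
  rw [← mul_smul_comm, h.x_mul_inv_U₀, Units.inv_mul_cancel_left]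
  abel

theorem U₁_eq : U₁ = (h.x⁻¹ : Bˣ) * (V₁ - b₁ • 1) := by
  have e : V₁ * (V₁ - b₁ • 1) = 1 := (heckeUnit h.sq_V₁).mul_inv
  have hx : ((h.x⁻¹ : Bˣ) : B) = U₁ * V₁ := rfl
  rw [hx, mul_assoc, e, mul_one]

theorem x_eq : (h.x : B) = (q : R) • (V₀ * U₀) := by
  have e0 : (U₀ - a₀ • 1) * U₀ = 1 := (heckeUnit h.sq_U₀).inv_mul
  rw [← smul_mul_assoc, h.x_mul_inv_U₀, mul_assoc, e0, mul_one]

theorem V₀_mul_x : V₀ * h.x =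
    ((q * q : Rˣ) : R) • ((h.x⁻¹ : Bˣ) * V₀) + ((q : R) * a₀) • 1 + b₀ • (h.x : B) := by
  conv_lhs => rw [h.x_eq, mul_smul_comm, ← mul_assoc, h.sq_V₀, add_mul, one_mul, smul_mul_assoc,
    smul_add, smul_comm, ← h.x_eq]
  nth_rw 2 [h.U₀_eq]
  rw [Units.val_mul]
  module

theorem V₁_mul_x_inv : V₁ * (h.x⁻¹ : Bˣ) = h.x * V₁ + a₁ • 1 + b₁ • ((h.x⁻¹ : Bˣ) : B) := by
  have hx : (h.x : B) = (V₁ - b₁ • 1) * (U₁ - a₁ • 1) := rfl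
  have hx' : ((h.x⁻¹ : Bˣ) : B) = U₁ * V₁ := rfl
  rw [hx, hx']
  simp only [sub_mul, mul_sub, mul_smul_comm, smul_mul_assoc, one_mul, mul_one, h.sq_V₁, mul_assoc]
  module

theorem V₀_eq : V₀ = ((q⁻¹ : Rˣ) : R) • ((V₁ - b₁ • 1) * (h.y⁻¹ : Bˣ)) := by
  have e : ((V₁ - b₁ • 1) * (h.y⁻¹ : Bˣ)) = (h.x : B) * (U₀ - a₀ • 1) :=
    (mul_assoc _ _ _).symm
  rw [e, ← h.x_mul_inv_U₀, smul_smul, Units.inv_mul, one_smul]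

theorem V₀_mul_V₁ : V₀ * V₁ = (q : R) • (h.y : B) + b₀ • V₁ - (b₀ * b₁) • 1 + b₁ • V₀ := by
  have e : V₁ - b₁ • 1 = (q : R) • (V₀ * h.y) := by
    have e0 : (q : R) • V₀ = (V₁ - b₁ • 1) * (h.y⁻¹ : Bˣ) := by
      conv_lhs => rw [h.V₀_eq, smul_smul, Units.mul_inv, one_smul]
    rw [← smul_mul_assoc, e0, Units.inv_mul_cancel_right]
  have e' : V₀ * (V₁ - b₁ • 1) = b₀ • (V₁ - b₁ • 1) + (q : R) • (h.y : B) := by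
    conv_lhs => rw [e, mul_smul_comm, ← mul_assoc, h.sq_V₀, add_mul, one_mul, smul_mul_assoc,
      smul_add, smul_comm, ← e]
  rw [mul_sub, mul_smul_comm, mul_one, sub_eq_iff_eq_add] at e'
  rw [e']
  module

end DAHARelations

/-- An operator satisfying a Bernstein-type relation with `x` preserves every `x`-stable submodule
as soon as it preserves it on a generating set. -/
theorem mul_zpow_mul_mem {R B : Type*} [CommRing R] [Ring B] [Algebra R B] (S : Submodule R B)
    (x : Bˣ) (hx : ∀ s ∈ S, (x : B) * s ∈ S) (hx' : ∀ s ∈ S, ((x⁻¹ : Bˣ) : B) * s ∈ S)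
    {V : B} {κ : Rˣ} {β v : R}
    (hV : V * x = (κ : R) • ((x⁻¹ : Bˣ) * V) + β • 1 + v • (x : B)) {b : B} (hb : b ∈ S)
    (hVb : V * b ∈ S) (n : ℤ) :
    ((x ^ n : Bˣ) : B) * b ∈ S ∧ V * (((x ^ n : Bˣ) : B) * b) ∈ S := by
  have hV' : V * (x⁻¹ : Bˣ) =
      ((κ⁻¹ : Rˣ) : R) • (x * V - β • 1 - v • (x : B)) := by
    have h1 : (x : B) * (V * x) * (x⁻¹ : Bˣ) = x * V := by simp [mul_assoc]
    rw [hV] at h1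
    simp only [mul_add, add_mul, mul_smul_comm, smul_mul_assoc, mul_one,
      Units.mul_inv_cancel_left, Units.mul_inv_cancel_right] at h1
    rw [Units.mul_inv] at h1
    have h2 : x * V - β • 1 - v • (x : B) = (κ : R) • (V * (x⁻¹ : Bˣ)) := by rw [← h1]; abel
    rw [h2, smul_smul, Units.inv_mul, one_smul]
  induction n using Int.induction_on with
  | zero => simpa using ⟨hb, hVb⟩
  | succ n ih =>
    rw [add_comm, zpow_add, zpow_one, Units.val_mul, mul_assoc, ← mul_assoc V, hV]
    refine ⟨hx _ ih.1, ?_⟩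
    simp only [add_mul, smul_mul_assoc, one_mul, mul_assoc]
    exact S.add_mem (S.add_mem (S.smul_mem _ (hx' _ ih.2)) (S.smul_mem _ ih.1))
      (S.smul_mem _ (hx _ ih.1))
  | pred n ih =>
    rw [sub_eq_add_neg, add_comm, zpow_add, zpow_neg_one, Units.val_mul, mul_assoc,
      ← mul_assoc V, hV']
    refine ⟨hx' _ ih.1, ?_⟩
    simp only [sub_mul, smul_mul_assoc, one_mul, mul_assoc]
    exact S.smul_mem _ (S.sub_mem (S.sub_mem (hx _ ih.2) (S.smul_mem _ ih.1))
      (S.smul_mem _ (hx _ ih.1)))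

namespace DAHARelations

variable {R B : Type*} [CommRing R] [Ring B] [Algebra R B] {q : Rˣ}
  {a₀ a₁ b₀ b₁ : R} {U₀ U₁ V₀ V₁ : B}

theorem span_monomial (h : DAHARelations q a₀ a₁ b₀ b₁ U₀ U₁ V₀ V₁)
    (hgen : Algebra.adjoin R {U₀, U₁, V₀, V₁} = ⊤) :
    Submodule.span R (Set.range h.monomial) = ⊤ := by
  set S := Submodule.span R (Set.range h.monomial) with hS
  have mem (n : ℤ) (ε : Bool) (m : ℤ) :
      ((h.x ^ n : Bˣ) : B) * ((if ε then V₁ else 1) * ((h.y ^ m : Bˣ) : B)) ∈ S := by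
    rw [← mul_assoc]
    exact Submodule.subset_span ⟨(n, ε, m), rfl⟩
  have ind (g : B) (hg : ∀ (n : ℤ) (ε : Bool) (m : ℤ),
      g * (((h.x ^ n : Bˣ) : B) * ((if ε then V₁ else 1) * ((h.y ^ m : Bˣ) : B))) ∈ S) :
      ∀ s ∈ S, g * s ∈ S := by
    have : S ≤ S.comap (LinearMap.mulLeft R g) := by
      rw [hS, Submodule.span_le]
      rintro _ ⟨⟨n, ε, m⟩, rfl⟩
      change g * (_ * _ * _) ∈ S
      rw [mul_assoc ((h.x ^ n : Bˣ) : B)]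
      exact hg n ε m
    exact this
  have hx : ∀ s ∈ S, (h.x : B) * s ∈ S := ind _ fun n ε m => by
    rw [← mul_assoc, ← Units.val_mul, ← zpow_one_add]
    exact mem _ _ _
  have hx' : ∀ s ∈ S, ((h.x⁻¹ : Bˣ) : B) * s ∈ S := ind _ fun n ε m => by
    rw [← mul_assoc, ← Units.val_mul, ← zpow_neg_one, ← zpow_add]
    exact mem _ _ _
  have hy (m : ℤ) : ((h.y ^ m : Bˣ) : B) ∈ S := by simpa using mem 0 false m
  have hVy (m : ℤ) : V₁ * ((h.y ^ m : Bˣ) : B) ∈ S := by simpa using mem 0 true m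
  have hV₁ : ∀ s ∈ S, V₁ * s ∈ S := ind _ fun n ε m => by
    have := mul_zpow_mul_mem S h.x⁻¹ hx' (by simpa using hx) (κ := 1) (V := V₁)
      (by rw [inv_inv, Units.val_one, one_smul]; exact h.V₁_mul_x_inv)
      (b := (if ε then V₁ else 1) * ((h.y ^ m : Bˣ) : B)) (by simpa using mem 0 ε m) ?_ (-n)
    · simpa using this.2
    · cases ε
      · simpa using hVy m
      · simp only [if_true, ← mul_assoc, h.sq_V₁, add_mul, smul_mul_assoc, one_mul]
        exact S.add_mem (S.smul_mem _ (hVy m)) (hy m)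
  have hV₀y (m : ℤ) : V₀ * ((h.y ^ m : Bˣ) : B) ∈ S := by
    rw [congrArg (· * ((h.y ^ m : Bˣ) : B)) h.V₀_eq, smul_mul_assoc, mul_assoc,
      ← Units.val_mul, ← zpow_neg_one h.y, ← zpow_add, sub_mul,
      smul_mul_assoc, one_mul]
    exact S.smul_mem _ (S.sub_mem (hVy _) (S.smul_mem _ (hy _)))
  have hV₀ : ∀ s ∈ S, V₀ * s ∈ S := ind _ fun n ε m => by
    refine (mul_zpow_mul_mem S h.x hx hx' h.V₀_mul_x (by simpa using mem 0 ε m) ?_ n).2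
    cases ε
    · simpa using hV₀y m
    · simp only [if_true, ← mul_assoc, h.V₀_mul_V₁, add_mul, sub_mul, smul_mul_assoc, one_mul]
      rw [← Units.val_mul, ← zpow_one_add]
      exact S.add_mem (S.sub_mem (S.add_mem (S.smul_mem _ (hy _)) (S.smul_mem _ (hVy _)))
        (S.smul_mem _ (hy _))) (S.smul_mem _ (hV₀y _))
  have hU₁ : ∀ s ∈ S, U₁ * s ∈ S := fun s hs => by
    rw [h.U₁_eq, mul_assoc, sub_mul, smul_mul_assoc, one_mul]
    exact hx' _ (S.sub_mem (hV₁ s hs) (S.smul_mem _ hs))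
  have hU₀ : ∀ s ∈ S, U₀ * s ∈ S := fun s hs => by
    rw [h.U₀_eq, add_mul, smul_mul_assoc, smul_mul_assoc, one_mul, mul_assoc]
    exact S.add_mem (S.smul_mem _ (hx' _ (hV₀ s hs))) (S.smul_mem _ hs)
  have all (g : B) : ∀ s ∈ S, g * s ∈ S := by
    have hg : g ∈ Algebra.adjoin R {U₀, U₁, V₀, V₁} := hgen ▸ Algebra.mem_top
    induction hg using Algebra.adjoin_induction with
    | mem g hg =>
      rcases hg with rfl | rfl | rfl | rfl
      exacts [hU₀, hU₁, hV₀, hV₁]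
    | algebraMap r => exact fun s hs => by rw [← Algebra.smul_def]; exact S.smul_mem _ hs
    | add g g' _ _ ih ih' =>
      intro s hs
      rw [add_mul]
      exact S.add_mem (ih s hs) (ih' s hs)
    | mul g g' _ _ ih ih' =>
      intro s hs
      rw [mul_assoc]
      exact ih _ (ih' s hs)
  exact eq_top_iff.2 fun g _ => by simpa using all g 1 (by simpa using hy 0)

end DAHARelations

/-- The Bernstein-type relations imply the defining relations of the DAHA. -/
theorem DAHARelations.of_bernstein {R B : Type*} [CommRing R] [Ring B] [Algebra R B] {q : Rˣ}
    {a₀ a₁ b₀ b₁ : R} {X Xi V₀ V₁ : B} (hX : X * Xi = 1) (hX' : Xi * X = 1)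
    (h₀ : V₀ * V₀ = b₀ • V₀ + 1) (h₁ : V₁ * V₁ = b₁ • V₁ + 1)
    (h₀X : V₀ * X = ((q * q : Rˣ) : R) • (Xi * V₀) + ((q : R) * a₀) • 1 + b₀ • X)
    (h₁X : V₁ * Xi = X * V₁ + a₁ • 1 + b₁ • Xi) :
    ∃ h : DAHARelations q a₀ a₁ b₀ b₁ (((q⁻¹ : Rˣ) : R) • ((V₀ - b₀ • 1) * X))
      (Xi * (V₁ - b₁ • 1)) V₀ V₁,
      (h.x : B) = X ∧ (h.y : B) * ((q : R) • (V₁ * V₀)) = 1 := by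
  have e0 : (V₀ - b₀ • 1) * V₀ = 1 := (heckeUnit h₀).inv_mul
  have e0' : V₀ * (V₀ - b₀ • 1) = 1 := (heckeUnit h₀).mul_inv
  have e1 : (V₁ - b₁ • 1) * V₁ = 1 := (heckeUnit h₁).inv_mul
  have e1' : V₁ * (V₁ - b₁ • 1) = 1 := (heckeUnit h₁).mul_inv
  have f0 : (V₀ - b₀ • 1) * X = ((q * q : Rˣ) : R) • (Xi * V₀) + ((q : R) * a₀) • 1 := by
    rw [sub_mul, h₀X, smul_mul_assoc, one_mul, add_sub_cancel_right]
  have f1 : (V₁ - b₁ • 1) * Xi = X * V₁ + a₁ • 1 := by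
    rw [sub_mul, h₁X, smul_mul_assoc, one_mul, add_sub_cancel_right]
  have hq : ((q⁻¹ : Rˣ) : R) * q = 1 := q.inv_mul
  let U₀ : B := ((q⁻¹ : Rˣ) : R) • ((V₀ - b₀ • 1) * X)
  let U₁ : B := Xi * (V₁ - b₁ • 1)
  have hU₀U₁ : U₀ * U₁ = ((q⁻¹ : Rˣ) : R) • ((V₀ - b₀ • 1) * (V₁ - b₁ • 1)) := by
    simp only [U₀, U₁, smul_mul_assoc]
    rw [mul_assoc, ← mul_assoc X, hX, one_mul]
  have h : DAHARelations q a₀ a₁ b₀ b₁ U₀ U₁ V₀ V₁ := by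
    refine ⟨?_, ?_, h₀, h₁, ?_⟩
    · have : U₀ * ((V₀ - b₀ • 1) * X) = ((q : R) * a₀) • U₀ + (q : R) • 1 := by
        rw [f0, mul_add, mul_smul_comm, mul_smul_comm, mul_one]
        simp only [U₀, smul_mul_assoc]
        rw [mul_assoc, ← mul_assoc X, hX, one_mul, e0, smul_smul, add_comm, Units.val_mul]
        congr 2
        linear_combination (q : R) * hq
      change U₀ * (((q⁻¹ : Rˣ) : R) • _) = _
      rw [mul_smul_comm, this, smul_add, smul_smul _ _ U₀, smul_smul _ (q : R) (1 : B), ← mul_assoc,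
        hq, one_mul, one_smul]
    · calc U₁ * U₁ = Xi * ((V₁ - b₁ • 1) * Xi) * (V₁ - b₁ • 1) := by simp only [U₁, mul_assoc]
        _ = (Xi * X) * (V₁ * (V₁ - b₁ • 1)) + a₁ • U₁ := by
          rw [f1]
          simp only [U₁, mul_add, add_mul, mul_smul_comm, smul_mul_assoc, mul_one, mul_assoc]
        _ = a₁ • U₁ + 1 := by rw [hX', e1', one_mul, add_comm]
    · rw [mul_assoc, hU₀U₁, mul_smul_comm, smul_smul, mul_comm (q : R), hq, one_smul, mul_assoc,
        ← mul_assoc V₀, e0', one_mul, e1']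
  refine ⟨h, ?_, ?_⟩
  · have hxi : ((h.x⁻¹ : Bˣ) : B) = Xi := by
      change Xi * (V₁ - b₁ • 1) * V₁ = Xi
      rw [mul_assoc, e1, mul_one]
    calc (h.x : B) = X * (Xi * h.x) := by rw [← mul_assoc, hX, one_mul]
      _ = X := by rw [← hxi, Units.inv_mul, mul_one]
  · change U₀ * U₁ * _ = 1
    rw [hU₀U₁, smul_mul_smul_comm, hq, one_smul, mul_assoc, ← mul_assoc _ V₁, e1, one_mul, e0]

open LaurentPolynomial in
/-- A free rank-two module over Laurent polynomials in two variables on which the DAHA acts so that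
`𝕏` is a multiplication operator and `(1, 0)` is an eigenvector of `𝕐`. -/
theorem exists_dahaRepresentation {R : Type*} [CommRing R] (q : Rˣ) (a₀ a₁ b₀ b₁ : R) :
    ∃ (U₀ U₁ V₀ V₁ : Module.End R[T;T⁻¹] (R[T;T⁻¹][T;T⁻¹] × R[T;T⁻¹][T;T⁻¹]))
      (h : DAHARelations q a₀ a₁ b₀ b₁ U₀ U₁ V₀ V₁),
      (∀ m : R[T;T⁻¹][T;T⁻¹] × R[T;T⁻¹][T;T⁻¹],
        (h.x : Module.End R[T;T⁻¹] (R[T;T⁻¹][T;T⁻¹] × R[T;T⁻¹][T;T⁻¹])) m =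
          (T 1 : R[T;T⁻¹][T;T⁻¹]) • m) ∧
      V₁ (1, 0) = (0, 1) ∧
      (h.y : Module.End R[T;T⁻¹] (R[T;T⁻¹][T;T⁻¹] × R[T;T⁻¹][T;T⁻¹])) (1, 0) =
        (T 1 : R[T;T⁻¹]) • (1, 0) := by
  let y : R[T;T⁻¹]ˣ :=
    ⟨T 1, T (-1), by rw [← T_add]; simp, by rw [← T_add]; simp⟩
  let f := algebraMap R R[T;T⁻¹]
  obtain ⟨X, Xi, V₀, V₁, hX, hXXi, hXiX, h₀, h₁, h₀X, h₁X, he, hy⟩ :=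
    exists_daha_operators (Units.map (f : R →* R[T;T⁻¹]) q) y (f a₀) (f a₁) (f b₀) (f b₁)
  rw [← map_mul] at h₀X
  simp only [Units.coe_map, MonoidHom.coe_coe] at h₀X
  rw [← map_mul] at h₀X
  simp only [f, algebraMap_smul] at h₀ h₁ h₀X h₁X
  obtain ⟨h, hx, hyi⟩ := DAHARelations.of_bernstein hXXi hXiX h₀ h₁ h₀X h₁X
  refine ⟨_, _, _, _, h, fun m => by rw [hx, hX], he, ?_⟩
  have := congrArg (fun g => g ((1, 0) : R[T;T⁻¹][T;T⁻¹] × R[T;T⁻¹][T;T⁻¹])) hyi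
  simp only [Module.End.mul_apply, LinearMap.smul_apply, Module.End.one_apply] at this
  generalize (h.y : Module.End R[T;T⁻¹] (R[T;T⁻¹][T;T⁻¹] × R[T;T⁻¹][T;T⁻¹])) = Y at this ⊢
  rw [hy, ← algebraMap_smul R[T;T⁻¹] (q : R), smul_smul, map_smul] at this
  have e : algebraMap R R[T;T⁻¹] q * (((Units.map (f : R →* R[T;T⁻¹]) q)⁻¹ * y⁻¹ : R[T;T⁻¹]ˣ) :
      R[T;T⁻¹]) = (y⁻¹ : R[T;T⁻¹]ˣ) :=
    congrArg Units.val (mul_inv_cancel_left (Units.map (f : R →* R[T;T⁻¹]) q) y⁻¹)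
  rw [e] at this
  rw [← this, smul_smul]
  change _ = ((y : R[T;T⁻¹]) * _) • _
  rw [Units.mul_inv, one_smul, this]

/-- The powers of a unit act on an eigenvector through the powers of the eigenvalue. -/
theorem zpow_apply_eq_zpow_smul {K M A : Type*} [CommRing K] [AddCommGroup M] [Module K M]
    [CommRing A] [Module A M] [SMulCommClass K A M] (x : (Module.End K M)ˣ) (t : Aˣ) (m : M)
    (hx : ∀ n : ℤ, (x : Module.End K M) (((t ^ n : Aˣ) : A) • m) =
      (t : A) • (((t ^ n : Aˣ) : A) • m)) (n : ℤ) :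
    ((x ^ n : (Module.End K M)ˣ) : Module.End K M) m = ((t ^ n : Aˣ) : A) • m := by
  have hx' (n : ℤ) : ((x⁻¹ : (Module.End K M)ˣ) : Module.End K M) (((t ^ n : Aˣ) : A) • m) =
      ((t ^ (n - 1) : Aˣ) : A) • m := by
    have := hx (n - 1)
    rw [smul_smul, ← Units.val_mul, ← zpow_one_add, add_sub_cancel] at this
    rw [← this, ← Module.End.mul_apply, Units.inv_mul, Module.End.one_apply]
  induction n using Int.induction_on with
  | zero => simp
  | succ n ih =>
    rw [add_comm, zpow_one_add, zpow_one_add, Units.val_mul, Module.End.mul_apply, ih, hx,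
      smul_smul, Units.val_mul]
  | pred n ih =>
    have : x ^ (-(n : ℤ) - 1) = x⁻¹ * x ^ (-(n : ℤ)) := by
      rw [← zpow_neg_one, ← zpow_add]; congr 1; ring
    rw [this, Units.val_mul, Module.End.mul_apply, ih, hx']

open LaurentPolynomial in
theorem LaurentPolynomial.linearIndependent_T_smul (R : Type*) [CommRing R] :
    LinearIndependent R (fun p : ℤ × Bool × ℤ =>
      (T p.1 : R[T;T⁻¹][T;T⁻¹]) • (T p.2.2 : R[T;T⁻¹]) •
        (if p.2.1 then (0, 1) else (1, 0) : R[T;T⁻¹][T;T⁻¹] × R[T;T⁻¹][T;T⁻¹])) := by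
  let F (p : ℤ × Bool × ℤ) : Module.Dual R (R[T;T⁻¹][T;T⁻¹] × R[T;T⁻¹][T;T⁻¹]) :=
    { toFun m := (((if p.2.1 then m.2 else m.1).coeff p.1).coeff p.2.2)
      map_add' m n := by cases p.2.1 <;> simp
      map_smul' r m := by cases p.2.1 <;> simp }
  have hF (p r : ℤ × Bool × ℤ) : F p ((T r.1 : R[T;T⁻¹][T;T⁻¹]) • (T r.2.2 : R[T;T⁻¹]) •
      (if r.2.1 then (0, 1) else (1, 0) : R[T;T⁻¹][T;T⁻¹] × R[T;T⁻¹][T;T⁻¹])) =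
      if p = r then 1 else 0 := by
    obtain ⟨n, ε, m⟩ := p
    obtain ⟨n', ε', m'⟩ := r
    cases ε <;> cases ε' <;>
      simp [F, T, -single_eq_C_mul_T, Finsupp.single_apply, eq_comm (a := n')]
    all_goals
      by_cases hn : n = n' <;> simp [hn, eq_comm]
  exact LinearIndependent.of_pairwise_dual_eq_zero_one _ F
    (fun p r hpr => (hF p r).trans (if_neg hpr)) (fun p => (hF p p).trans (if_pos rfl))

open LaurentPolynomial in
theorem DAHARelations.linearIndependent_monomial {R B : Type*} [CommRing R] [Ring B] [Algebra R B]
    {q : Rˣ} {a₀ a₁ b₀ b₁ : R} {U₀ U₁ V₀ V₁ : B}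
    (h : DAHARelations q a₀ a₁ b₀ b₁ U₀ U₁ V₀ V₁)
    (hlift : ∀ {U₀' U₁' V₀' V₁' :
        Module.End R[T;T⁻¹] (R[T;T⁻¹][T;T⁻¹] × R[T;T⁻¹][T;T⁻¹])},
      DAHARelations q a₀ a₁ b₀ b₁ U₀' U₁' V₀' V₁' →
        ∃ φ : B →ₐ[R] Module.End R[T;T⁻¹] (R[T;T⁻¹][T;T⁻¹] × R[T;T⁻¹][T;T⁻¹]),
          φ U₀ = U₀' ∧ φ U₁ = U₁' ∧ φ V₀ = V₀' ∧ φ V₁ = V₁') :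
    LinearIndependent R h.monomial := by
  obtain ⟨U₀', U₁', V₀', V₁', h', hx, hV, hy⟩ := exists_dahaRepresentation q a₀ a₁ b₀ b₁
  obtain ⟨φ, hU₀', hU₁', -, hV₁'⟩ := hlift h'
  have hφx : Units.map (φ : B →* _) h.x = h'.x := by
    ext1
    change φ ((V₁ - b₁ • 1) * (U₁ - a₁ • 1)) = (V₁' - b₁ • 1) * (U₁' - a₁ • 1)
    simp only [map_mul, map_sub, map_smul, map_one, hU₁', hV₁']
  have hφy : Units.map (φ : B →* _) h.y = h'.y := by
    ext1
    change φ (U₀ * U₁) = U₀' * U₁'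
    simp only [map_mul, hU₀', hU₁']
  have hφxn (n : ℤ) : φ ((h.x ^ n : Bˣ) : B) = ((h'.x ^ n : (Module.End _ _)ˣ) : Module.End _ _) := by
    rw [← hφx, ← map_zpow]; rfl
  have hφyn (n : ℤ) : φ ((h.y ^ n : Bˣ) : B) = ((h'.y ^ n : (Module.End _ _)ˣ) : Module.End _ _) := by
    rw [← hφy, ← map_zpow]; rfl
  let t (A : Type _) [CommRing A] : A[T;T⁻¹]ˣ :=
    ⟨T 1, T (-1), by rw [← T_add]; simp, by rw [← T_add]; simp⟩
  have ht (A : Type _) [CommRing A] (n : ℤ) : ((t A ^ n : A[T;T⁻¹]ˣ) : A[T;T⁻¹]) = T n := by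
    induction n using Int.induction_on with
    | zero => simp
    | succ n ih => rw [zpow_add_one, Units.val_mul, ih, T_add]
    | pred n ih => rw [zpow_sub_one, Units.val_mul, ih, sub_eq_add_neg, T_add]; rfl
  let ev : B →ₗ[R] R[T;T⁻¹][T;T⁻¹] × R[T;T⁻¹][T;T⁻¹] :=
    { toFun g := φ g (1, 0)
      map_add' g g' := by simp
      map_smul' r g := by simp }
  refine LinearIndependent.of_comp ev ?_
  convert LaurentPolynomial.linearIndependent_T_smul R using 1
  funext ⟨n, ε, m⟩
  have hyn := zpow_apply_eq_zpow_smul h'.y (t R) (1, 0)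
    (fun k => by rw [map_smul, hy, smul_comm]) m
  have hxn (v) := zpow_apply_eq_zpow_smul h'.x (t R[T;T⁻¹]) v (fun k => hx _) n
  rw [ht] at hyn
  simp only [ht] at hxn
  change φ (_ * _ * _) (1, 0) = _
  rw [map_mul, map_mul, hφxn, hφyn, Module.End.mul_apply, Module.End.mul_apply, hyn, hxn, map_smul]
  cases ε
  · simp
  · simp [hV₁', hV]

theorem sub_algebraMap_add_algebraMap {R B : Type*} [CommRing R] [Ring B] [Algebra R B] (x : B)
    (a a' : R) : x - algebraMap R B a + algebraMap R B a' = x - (a - a') • 1 := by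
  simp only [Algebra.algebraMap_eq_smul_one, sub_smul]; abel

namespace R5

theorem single_mul_single_neg (e : ℤ × ℤ × ℤ × ℤ × ℤ) :
    (AddMonoidAlgebra.single e 1 * AddMonoidAlgebra.single (-e) 1 : R5) = 1 := by
  rw [AddMonoidAlgebra.single_mul_single, add_neg_cancel, mul_one]; rfl

/-- `q^{1/4}` as a unit. -/
def qUnit : R5ˣ where
  val := q4
  inv := q4i
  val_inv := single_mul_single_neg _
  inv_val := (mul_comm _ _).trans (single_mul_single_neg (1, 0, 0, 0, 0))

theorem u0h_mul : u0h * u0hi = 1 := single_mul_single_neg _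
theorem u1h_mul : u1h * u1hi = 1 := single_mul_single_neg _
theorem v0h_mul : v0h * v0hi = 1 := single_mul_single_neg _
theorem v1h_mul : v1h * v1hi = 1 := single_mul_single_neg _

end R5

namespace H

open R5

theorem dahaRelations :
    DAHARelations qUnit (u0h - u0hi) (u1h - u1hi) (v0h - v0hi) (v1h - v1hi) U0 U1 V0 V1 where
  sq_U₀ := (hecke_factor_eq_zero_iff u0h_mul _).1 <| by
    simpa [U0] using RingQuot.mkAlgHom_rel R5 Crel.heckeU0
  sq_U₁ := (hecke_factor_eq_zero_iff u1h_mul _).1 <| by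
    simpa [U1] using RingQuot.mkAlgHom_rel R5 Crel.heckeU1
  sq_V₀ := (hecke_factor_eq_zero_iff v0h_mul _).1 <| by
    simpa [V0] using RingQuot.mkAlgHom_rel R5 Crel.heckeV0
  sq_V₁ := (hecke_factor_eq_zero_iff v1h_mul _).1 <| by
    simpa [V1] using RingQuot.mkAlgHom_rel R5 Crel.heckeV1
  prod_eq := by
    have := RingQuot.mkAlgHom_rel R5 Crel.unit
    simp only [map_mul, AlgHom.commutes, map_one] at this
    rw [Algebra.smul_def, ← mul_assoc, ← mul_assoc, ← mul_assoc]
    exact this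

theorem exists_lift {B : Type*} [Ring B] [Algebra R5 B] {U₀ U₁ V₀ V₁ : B}
    (h : DAHARelations qUnit (u0h - u0hi) (u1h - u1hi) (v0h - v0hi) (v1h - v1hi) U₀ U₁ V₀ V₁) :
    ∃ φ : H →ₐ[R5] B, φ U0 = U₀ ∧ φ U1 = U₁ ∧ φ V0 = V₀ ∧ φ V1 = V₁ := by
  let g : Cgen → B
    | .u0 => U₀
    | .u1 => U₁
    | .v0 => V₀
    | .v1 => V₁
  have hg ⦃a b : FreeAlgebra R5 Cgen⦄ (hab : Crel a b) :
      FreeAlgebra.lift R5 g a = FreeAlgebra.lift R5 g b := by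
    induction hab with
    | heckeU0 => simpa [g] using (hecke_factor_eq_zero_iff u0h_mul _).2 h.sq_U₀
    | heckeU1 => simpa [g] using (hecke_factor_eq_zero_iff u1h_mul _).2 h.sq_U₁
    | heckeV0 => simpa [g] using (hecke_factor_eq_zero_iff v0h_mul _).2 h.sq_V₀
    | heckeV1 => simpa [g] using (hecke_factor_eq_zero_iff v1h_mul _).2 h.sq_V₁
    | unit =>
      have := h.prod_eq
      rw [Algebra.smul_def, ← mul_assoc, ← mul_assoc, ← mul_assoc] at this
      simp only [map_mul, AlgHom.commutes, map_one, FreeAlgebra.lift_ι_apply]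
      exact this
  refine ⟨RingQuot.liftAlgHom R5 ⟨FreeAlgebra.lift R5 g, hg⟩, ?_, ?_, ?_, ?_⟩
  all_goals exact (RingQuot.liftAlgHom_mkAlgHom_apply ..).trans (FreeAlgebra.lift_ι_apply ..)

theorem adjoin_generators : Algebra.adjoin R5 {U0, U1, V0, V1} = (⊤ : Subalgebra R5 H) := by
  have := congrArg (Subalgebra.map (RingQuot.mkAlgHom R5 Crel))
    (FreeAlgebra.adjoin_range_ι R5 Cgen)
  rw [AlgHom.map_adjoin, Algebra.map_top,
    (AlgHom.range_eq_top _).2 (RingQuot.mkAlgHom_surjective R5 Crel)] at this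
  rw [eq_top_iff, ← this]
  refine Algebra.adjoin_mono ?_
  rintro _ ⟨_, ⟨i, rfl⟩, rfl⟩
  cases i
  · exact Or.inl rfl
  · exact Or.inr (Or.inl rfl)
  · exact Or.inr (Or.inr (Or.inl rfl))
  · exact Or.inr (Or.inr (Or.inr rfl))

theorem sub_c_add_c (x : H) (a a' : R5) : x - c a + c a' = x - (a - a') • 1 :=
  sub_algebraMap_add_algebraMap x a a'

theorem zpow_eq_ite {B : Type*} [Monoid B] (x : Bˣ) (n : ℤ) :
    ((x ^ n : Bˣ) : B) =
      if 0 ≤ n then (x : B) ^ n.toNat else ((x⁻¹ : Bˣ) : B) ^ (-n).toNat := by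
  split_ifs with hn
  · rw [← Units.val_pow_eq_pow_val, ← zpow_natCast, Int.toNat_of_nonneg hn]
  · rw [← Units.val_pow_eq_pow_val, ← zpow_natCast, Int.toNat_of_nonneg (by omega), inv_zpow,
      zpow_neg, inv_inv]

theorem pbw_eq_monomial : pbw = dahaRelations.monomial := by
  have hX : (dahaRelations.x : H) = XX := by
    rw [XX, V1i, U1i, sub_c_add_c, sub_c_add_c]; rfl
  have hYi : ((dahaRelations.y⁻¹ : Hˣ) : H) = YYi := by
    rw [YYi, U0i, U1i, sub_c_add_c, sub_c_add_c]; rfl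
  have hXi : ((dahaRelations.x⁻¹ : Hˣ) : H) = XXi := rfl
  have hY : (dahaRelations.y : H) = YY := rfl
  funext p
  rw [pbw, DAHARelations.monomial, xpow, ypow, zpow_eq_ite, zpow_eq_ite, hX, hY, hXi, hYi]

end H

/-- PBW theorem for the `C∨C₁` DAHA: the family
`{𝕏^n·V₁^ε·𝕐^m : n, m ∈ ℤ, ε ∈ {0,1}}` is a basis of `H` as an `R`-module, i.e. it is
linearly independent over `R` and spans `H`. -/
theorem statement15 :
    LinearIndependent R5 H.pbw ∧ Submodule.span R5 (Set.range H.pbw) = ⊤ := by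
  rw [H.pbw_eq_monomial]
  exact ⟨H.dahaRelations.linearIndependent_monomial H.exists_lift,
    H.dahaRelations.span_monomial H.adjoin_generators⟩
end
end

section
/- The symmetric Askey–Wilson polynomial of degree 1, P₁ = 𝕏 + 𝕏⁻¹ + (q^{1/4}·u₀^{1/2}·v₀^{−1/2}·(1 + u₁)·(1 − v₀) + u₁^{1/2}·v₁^{−1/2}·(1 + q^{1/2}·u₀)·(1 − v₁))/(1 − q^{1/2}·u₀·u₁), satisfies (Ŷ + Ŷ⁻¹)(P₁) = ((u₀·u₁)^{1/2}·q^{1/2} + (u₀·u₁)^{−1/2}·q^{−1/2})·P₁. -/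
noncomputable section

/-- The field `F = ℚ(q^{1/4}, u₀^{1/2}, u₁^{1/2}, v₀^{1/2}, v₁^{1/2})` of rational
functions in five independent variables. -/
abbrev F : Type := FractionRing (MvPolynomial (Fin 5) ℚ)

namespace F
/-- `q^{1/4}` -/
def q4 : F := algebraMap (MvPolynomial (Fin 5) ℚ) F (MvPolynomial.X 0)
/-- `u₀^{1/2}` -/
def u0h : F := algebraMap (MvPolynomial (Fin 5) ℚ) F (MvPolynomial.X 1)
/-- `u₁^{1/2}` -/
def u1h : F := algebraMap (MvPolynomial (Fin 5) ℚ) F (MvPolynomial.X 2)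
/-- `v₀^{1/2}` -/
def v0h : F := algebraMap (MvPolynomial (Fin 5) ℚ) F (MvPolynomial.X 3)
/-- `v₁^{1/2}` -/
def v1h : F := algebraMap (MvPolynomial (Fin 5) ℚ) F (MvPolynomial.X 4)
/-- `q^{1/2}` -/
def q2 : F := q4 ^ 2
/-- `u₀` -/
def u0 : F := u0h ^ 2
/-- `u₁` -/
def u1 : F := u1h ^ 2
/-- `v₀` -/
def v0 : F := v0h ^ 2
/-- `v₁` -/
def v1 : F := v1h ^ 2
end F

/-- The Laurent polynomial ring `L_F = F[𝕏^{±1}]`. -/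
abbrev LF : Type := LaurentPolynomial F

/-- `𝕏₀ = q^{1/4}·𝕏⁻¹` and `𝕏₁ = 𝕏` -/
def Xl : Fin 2 → LF :=
  ![LaurentPolynomial.C F.q4 * LaurentPolynomial.T (-1), LaurentPolynomial.T 1]

def uh : Fin 2 → F := ![F.u0h, F.u1h]
def vh : Fin 2 → F := ![F.v0h, F.v1h]

/-- defining property of the operators `s₁, s₀`:
`s₁(𝕏^m) = 𝕏^{−m}` and `s₀(𝕏^m) = q^{m/2}·𝕏^{−m}`. -/
def Sconds (s : Fin 2 → Module.End F LF) : Prop :=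
  (∀ m : ℤ, s 1 (LaurentPolynomial.T m) = LaurentPolynomial.T (-m)) ∧
  (∀ m : ℤ, s 0 (LaurentPolynomial.T m) = (F.q2 ^ m) • LaurentPolynomial.T (-m))

/-- defining property of the Demazure–Lusztig operators `Û_i`:
`Û_i(f) = u_i^{1/2}·s_i(f) + ((u_i^{1/2} − u_i^{−1/2}) + (v_i^{1/2} − v_i^{−1/2})·𝕏_i)·g`
whenever `(1 − 𝕏_i²)·g = f − s_i(f)`. -/
def Uconds (s U : Fin 2 → Module.End F LF) : Prop :=
  ∀ (i : Fin 2) (f g : LF), (1 - Xl i ^ 2) * g = f - s i f →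
    U i f = uh i • s i f +
      (LaurentPolynomial.C (uh i - (uh i)⁻¹) +
        LaurentPolynomial.C (vh i - (vh i)⁻¹) * Xl i) * g

/-- defining property of the inverse operators `Û_i'`:
`Û_i'(f) = u_i^{−1/2}·s_i(f) + ((u_i^{1/2} − u_i^{−1/2})·𝕏_i² + (v_i^{1/2} − v_i^{−1/2})·𝕏_i)·g`
whenever `(1 − 𝕏_i²)·g = f − s_i(f)`. -/
def U'conds (s U' : Fin 2 → Module.End F LF) : Prop :=
  ∀ (i : Fin 2) (f g : LF), (1 - Xl i ^ 2) * g = f - s i f →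
    U' i f = (uh i)⁻¹ • s i f +
      (LaurentPolynomial.C (uh i - (uh i)⁻¹) * Xl i ^ 2 +
        LaurentPolynomial.C (vh i - (vh i)⁻¹) * Xl i) * g


open LaurentPolynomial in
/-- the symmetric Askey–Wilson polynomial `P₁` -/
def P1 : LF :=
  T 1 + T (-1) +
    C ((F.q4 * F.u0h * F.v0h⁻¹ * (1 + F.u1) * (1 - F.v0) +
        F.u1h * F.v1h⁻¹ * (1 + F.q2 * F.u0) * (1 - F.v1)) / (1 - F.q2 * F.u0 * F.u1))

section LaurentOperators

open LaurentPolynomial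

variable {K : Type*} [Field K]

theorem exists_end_apply_T (φ : ℤ → LaurentPolynomial K) :
    ∃ D : Module.End K (LaurentPolynomial K), ∀ m : ℤ, D (T m) = φ m := by
  refine ⟨Finsupp.linearCombination K φ ∘ₗ
    (AddMonoidAlgebra.coeffLinearEquiv K).toLinearMap, fun m => ?_⟩
  have h : (T m : LaurentPolynomial K).coeff = Finsupp.single m 1 := rfl
  simp [h]

theorem exists_end_mul_eq_sub (s : Module.End K (LaurentPolynomial K)) (d : LaurentPolynomial K)
    (h : ∀ m : ℤ, d ∣ T m - s (T m)) :
    ∃ D : Module.End K (LaurentPolynomial K), ∀ f, d * D f = f - s f := by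
  choose φ hφ using h
  obtain ⟨D, hD⟩ := exists_end_apply_T φ
  refine ⟨D, fun f => ?_⟩
  induction f using LaurentPolynomial.induction_on' with
  | add p r hp hr => rw [map_add, map_add, mul_add, hp, hr]; ring
  | C_mul_T n a =>
    rw [← smul_eq_C_mul, map_smul, map_smul, hD, mul_smul_comm, ← hφ, smul_sub]

theorem one_sub_dvd_one_sub_zpow {R : Type*} [CommRing R] (w : Rˣ) (m : ℤ) :
    (1 - (w : R)) ∣ 1 - ((w ^ m : Rˣ) : R) := by
  obtain ⟨n, rfl | rfl⟩ := m.eq_nat_or_neg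
  · simpa using one_sub_dvd_one_sub_pow (w : R) n
  · have h : 1 - ((w ^ (-(n : ℤ)) : Rˣ) : R) =
        -((w ^ (-(n : ℤ)) : Rˣ) : R) * (1 - (w : R) ^ n) := by
      have : ((w ^ (-(n : ℤ)) : Rˣ) : R) * (w : R) ^ n = 1 := by
        rw [← Units.val_pow_eq_pow_val, ← Units.val_mul]; simp
      linear_combination -this
    rw [h]
    exact (one_sub_dvd_one_sub_pow _ n).mul_left _

theorem one_sub_C_mul_T_dvd {a : K} (ha : a ≠ 0) (k m : ℤ) :
    (1 - C a * T k) ∣ (1 - C (a ^ m) * T (m * k) : LaurentPolynomial K) := by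
  let φ : Multiplicative ℤ →* LaurentPolynomial K := AddMonoidAlgebra.of K ℤ
  let w : (LaurentPolynomial K)ˣ :=
    Units.map (C (R := K)).toMonoidHom (Units.mk0 a ha) *
      Units.map φ (toUnits (Multiplicative.ofAdd k))
  have h (j : ℤ) : ((w ^ j : (LaurentPolynomial K)ˣ) : LaurentPolynomial K) =
      C (a ^ j) * T (j * k) := by
    have hφ : φ (Multiplicative.ofAdd k ^ j) = T (j * k) := by
      rw [← ofAdd_zsmul, smul_eq_mul]; rfl
    have ha' : a ^ j = ((Units.mk0 a ha ^ j : Kˣ) : K) := by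
      rw [Units.val_zpow_eq_zpow_val, Units.val_mk0]
    rw [mul_zpow, ← map_zpow (Units.map (C (R := K)).toMonoidHom), ← map_zpow (Units.map φ),
      ← map_zpow toUnits, ← hφ, ha']
    rfl
  have := one_sub_dvd_one_sub_zpow w m
  rwa [h, ← zpow_one w, h, zpow_one, one_mul] at this

theorem one_sub_C_mul_T_ne_zero (a : K) {k : ℤ} (hk : k ≠ 0) :
    (1 - C a * T k : LaurentPolynomial K) ≠ 0 := by
  intro h
  have := congrArg (fun f : LaurentPolynomial K => f.coeff 0) h
  rw [← T_zero, ← smul_eq_C_mul] at this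
  simp [hk] at this

end LaurentOperators

section AskeyWilson

open LaurentPolynomial

theorem algebraMap_F_ne_zero {p : MvPolynomial (Fin 5) ℚ} (hp : p ≠ 0) :
    algebraMap (MvPolynomial (Fin 5) ℚ) F p ≠ 0 := by
  simpa using hp

theorem F.q4_ne_zero : F.q4 ≠ 0 := algebraMap_F_ne_zero (MvPolynomial.X_ne_zero _)
theorem F.u0h_ne_zero : F.u0h ≠ 0 := algebraMap_F_ne_zero (MvPolynomial.X_ne_zero _)
theorem F.u1h_ne_zero : F.u1h ≠ 0 := algebraMap_F_ne_zero (MvPolynomial.X_ne_zero _)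
theorem F.v0h_ne_zero : F.v0h ≠ 0 := algebraMap_F_ne_zero (MvPolynomial.X_ne_zero _)
theorem F.v1h_ne_zero : F.v1h ≠ 0 := algebraMap_F_ne_zero (MvPolynomial.X_ne_zero _)

theorem F.q2_ne_zero : F.q2 ≠ 0 := pow_ne_zero 2 F.q4_ne_zero

theorem F.one_sub_q2_mul_u0_mul_u1_ne_zero : 1 - F.q2 * F.u0 * F.u1 ≠ 0 := by
  have h : (1 - MvPolynomial.X 0 ^ 2 * MvPolynomial.X 1 ^ 2 * MvPolynomial.X 2 ^ 2 :
      MvPolynomial (Fin 5) ℚ) ≠ 0 := by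
    intro h
    simpa using congrArg (MvPolynomial.eval 0) h
  have := algebraMap_F_ne_zero h
  rwa [map_sub, map_one, map_mul, map_mul, map_pow, map_pow, map_pow] at this

theorem Xl_zero_sq : Xl 0 ^ 2 = C F.q2 * T (-2) := by
  simp [Xl, F.q2, mul_pow, T_pow]

theorem Xl_one_sq : Xl 1 ^ 2 = T 2 := by
  simp [Xl, T_pow]

theorem one_sub_Xl_sq_ne_zero (i : Fin 2) : 1 - Xl i ^ 2 ≠ 0 := by
  fin_cases i
  · simpa [Xl_zero_sq] using one_sub_C_mul_T_ne_zero F.q2 (k := -2) (by norm_num)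
  · simpa [Xl_one_sq] using one_sub_C_mul_T_ne_zero (1 : F) (k := 2) (by norm_num)

theorem Sconds.one_sub_Xl_sq_dvd {s : Fin 2 → Module.End F LF} (hs : Sconds s) (i : Fin 2)
    (m : ℤ) : (1 - Xl i ^ 2) ∣ T m - s i (T m) := by
  fin_cases i
  · have h : T m - s 0 (T m) = T m * (1 - C (F.q2 ^ m) * T (m * -2)) := by
      rw [hs.2, smul_eq_C_mul, mul_sub, mul_one, mul_left_comm, ← T_add]
      ring_nf
    change (1 - Xl 0 ^ 2) ∣ T m - s 0 (T m)
    rw [h, Xl_zero_sq]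
    exact (one_sub_C_mul_T_dvd F.q2_ne_zero _ _).mul_left _
  · have h : T m - s 1 (T m) = T m * (1 - C ((1 : F) ^ (-m)) * T (-m * 2)) := by
      rw [hs.1, one_zpow, map_one, one_mul, mul_sub, mul_one, ← T_add]
      ring_nf
    change (1 - Xl 1 ^ 2) ∣ T m - s 1 (T m)
    rw [h, Xl_one_sq]
    have := one_sub_C_mul_T_dvd (one_ne_zero (α := F)) 2 (-m)
    rw [map_one, one_mul] at this
    exact this.mul_left _

theorem exists_Sconds : ∃ s : Fin 2 → Module.End F LF, Sconds s := by
  obtain ⟨s₁, h₁⟩ := exists_end_apply_T (K := F) fun m => T (-m)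
  obtain ⟨s₀, h₀⟩ := exists_end_apply_T (K := F) fun m => (F.q2 ^ m) • T (-m)
  exact ⟨![s₀, s₁], h₁, h₀⟩

theorem Sconds.exists_Uconds_U'conds {s : Fin 2 → Module.End F LF} (hs : Sconds s) :
    ∃ U U' : Fin 2 → Module.End F LF, Uconds s U ∧ U'conds s U' := by
  choose D hD using fun i => exists_end_mul_eq_sub (s i) (1 - Xl i ^ 2) (hs.one_sub_Xl_sq_dvd i)
  have hg {i : Fin 2} {f g : LF} (h : (1 - Xl i ^ 2) * g = f - s i f) : D i f = g :=
    mul_left_cancel₀ (one_sub_Xl_sq_ne_zero i) ((hD i f).trans h.symm)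
  refine ⟨fun i => uh i • s i + LinearMap.mulLeft F
      (C (uh i - (uh i)⁻¹) + C (vh i - (vh i)⁻¹) * Xl i) ∘ₗ D i,
    fun i => (uh i)⁻¹ • s i + LinearMap.mulLeft F
      (C (uh i - (uh i)⁻¹) * Xl i ^ 2 + C (vh i - (vh i)⁻¹) * Xl i) ∘ₗ D i, ?_, ?_⟩
  · intro i f g h
    simp [hg h]
  · intro i f g h
    simp [hg h]

/-- The constant term of `P1`. -/
def P1const : F :=
  (F.q4 * F.u0h * F.v0h⁻¹ * (1 + F.u1) * (1 - F.v0) +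
    F.u1h * F.v1h⁻¹ * (1 + F.q2 * F.u0) * (1 - F.v1)) / (1 - F.q2 * F.u0 * F.u1)

/-- The Laurent polynomial `a 𝕏 + b 𝕏⁻¹ + c`. -/
def trinomial (a b c : F) : LF := C a * T 1 + C b * T (-1) + C c

theorem P1_eq_trinomial : P1 = trinomial 1 1 P1const := by
  simp [P1, trinomial, P1const]

theorem smul_trinomial (r a b c : F) :
    r • trinomial a b c = trinomial (r * a) (r * b) (r * c) := by
  simp only [trinomial, smul_eq_C_mul, map_mul]
  ring

theorem trinomial_add (a b c a' b' c' : F) :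
    trinomial a b c + trinomial a' b' c' = trinomial (a + a') (b + b') (c + c') := by
  simp only [trinomial, map_add]
  ring

theorem Sconds.zero_trinomial {s : Fin 2 → Module.End F LF} (hs : Sconds s) (a b c : F) :
    s 0 (trinomial a b c) = trinomial (F.q2⁻¹ * b) (F.q2 * a) c := by
  have hc : s 0 (C c) = C c := by
    have h : s 0 1 = 1 := by simpa using hs.2 0
    rw [← mul_one (C c), ← smul_eq_C_mul, map_smul, h]
  simp only [trinomial, ← smul_eq_C_mul, map_add, map_smul, hc, hs.2]
  simp only [smul_eq_C_mul, map_mul, zpow_neg, zpow_one, neg_neg]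
  ring

theorem Sconds.one_trinomial {s : Fin 2 → Module.End F LF} (hs : Sconds s) (a b c : F) :
    s 1 (trinomial a b c) = trinomial b a c := by
  have hc : s 1 (C c) = C c := by
    have h : s 1 1 = 1 := by simpa using hs.1 0
    rw [← mul_one (C c), ← smul_eq_C_mul, map_smul, h]
  simp only [trinomial, ← smul_eq_C_mul, map_add, map_smul, hc, hs.1, neg_neg]
  ring

theorem T_one_mul_T_neg_one : (T 1 * T (-1) : LF) = 1 := by
  rw [← T_add, add_neg_cancel, T_zero]

theorem Sconds.one_sub_Xl_zero_sq_mul {s : Fin 2 → Module.End F LF} (hs : Sconds s)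
    (a b c : F) : (1 - Xl 0 ^ 2) * (C (a - F.q2⁻¹ * b) * T 1) =
      trinomial a b c - s 0 (trinomial a b c) := by
  have hq : (C F.q2 * C F.q2⁻¹ : LF) = 1 := by
    rw [← map_mul, mul_inv_cancel₀ F.q2_ne_zero, map_one]
  have hT : (T (-2) * T 1 : LF) = T (-1) := by rw [← T_add]; norm_num
  rw [hs.zero_trinomial, Xl_zero_sq]
  simp only [trinomial, map_sub, map_mul]
  linear_combination (-C F.q2 * C a + C F.q2 * C F.q2⁻¹ * C b) * hT + C b * T (-1) * hq

theorem Sconds.one_sub_Xl_one_sq_mul {s : Fin 2 → Module.End F LF} (hs : Sconds s)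
    (a b c : F) : (1 - Xl 1 ^ 2) * (C (b - a) * T (-1)) =
      trinomial a b c - s 1 (trinomial a b c) := by
  have hT : (T 2 * T (-1) : LF) = T 1 := by rw [← T_add]; norm_num
  rw [hs.one_trinomial, Xl_one_sq]
  simp only [trinomial, map_sub]
  linear_combination (C a - C b) * hT

theorem Uconds.zero_trinomial {s U : Fin 2 → Module.End F LF} (hs : Sconds s) (hU : Uconds s U)
    (a b c : F) : U 0 (trinomial a b c) =
      trinomial (F.u0h * (F.q2⁻¹ * b) + (F.u0h - F.u0h⁻¹) * (a - F.q2⁻¹ * b)) (F.u0h * (F.q2 * a))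
        (F.u0h * c + (F.v0h - F.v0h⁻¹) * F.q4 * (a - F.q2⁻¹ * b)) := by
  rw [hU 0 _ _ (hs.one_sub_Xl_zero_sq_mul a b c), hs.zero_trinomial, smul_trinomial]
  simp only [trinomial, uh, vh, Xl, Matrix.cons_val_zero, map_add, map_mul]
  linear_combination C (F.v0h - F.v0h⁻¹) * C F.q4 * C (a - F.q2⁻¹ * b) * T_one_mul_T_neg_one

theorem Uconds.one_trinomial {s U : Fin 2 → Module.End F LF} (hs : Sconds s) (hU : Uconds s U)
    (a c : F) : U 1 (trinomial a a c) = F.u1h • trinomial a a c := by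
  simpa [hs.one_trinomial, uh] using
    hU 1 _ _ (hs.one_sub_Xl_one_sq_mul a a c)

theorem U'conds.zero_trinomial {s U' : Fin 2 → Module.End F LF} (hs : Sconds s)
    (hU' : U'conds s U') (a b c : F) : U' 0 (trinomial a b c) =
      trinomial (F.u0h⁻¹ * (F.q2⁻¹ * b))
        (F.u0h⁻¹ * (F.q2 * a) + (F.u0h - F.u0h⁻¹) * F.q2 * (a - F.q2⁻¹ * b))
        (F.u0h⁻¹ * c + (F.v0h - F.v0h⁻¹) * F.q4 * (a - F.q2⁻¹ * b)) := by
  have hT : (T (-2) * T 1 : LF) = T (-1) := by rw [← T_add]; norm_num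
  rw [hU' 0 _ _ (hs.one_sub_Xl_zero_sq_mul a b c), hs.zero_trinomial, smul_trinomial, Xl_zero_sq]
  simp only [trinomial, uh, vh, Xl, Matrix.cons_val_zero, map_add, map_mul]
  linear_combination C (F.v0h - F.v0h⁻¹) * C F.q4 * C (a - F.q2⁻¹ * b) * T_one_mul_T_neg_one +
    C (F.u0h - F.u0h⁻¹) * C F.q2 * C (a - F.q2⁻¹ * b) * hT

theorem U'conds.one_trinomial {s U' : Fin 2 → Module.End F LF} (hs : Sconds s)
    (hU' : U'conds s U') (a b c : F) : U' 1 (trinomial a b c) =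
      trinomial (F.u1h⁻¹ * b + (F.u1h - F.u1h⁻¹) * (b - a)) (F.u1h⁻¹ * a)
        (F.u1h⁻¹ * c + (F.v1h - F.v1h⁻¹) * (b - a)) := by
  have hT : (T 2 * T (-1) : LF) = T 1 := by rw [← T_add]; norm_num
  rw [hU' 1 _ _ (hs.one_sub_Xl_one_sq_mul a b c), hs.one_trinomial, smul_trinomial, Xl_one_sq]
  simp only [trinomial, uh, vh, Xl, Matrix.cons_val_one, Matrix.cons_val_fin_one, map_add, map_mul]
  linear_combination C (F.v1h - F.v1h⁻¹) * C (b - a) * T_one_mul_T_neg_one +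
    C (F.u1h - F.u1h⁻¹) * C (b - a) * hT

theorem P1_eigen {s U U' : Fin 2 → Module.End F LF} (hs : Sconds s) (hU : Uconds s U)
    (hU' : U'conds s U') : U 0 (U 1 P1) + U' 1 (U' 0 P1) =
      (F.u0h * F.u1h * F.q2 + (F.u0h * F.u1h)⁻¹ * F.q2⁻¹) • P1 := by
  rw [P1_eq_trinomial, hU.one_trinomial hs, map_smul, hU.zero_trinomial hs,
    hU'.zero_trinomial hs, hU'.one_trinomial hs, smul_trinomial, smul_trinomial, trinomial_add]
  have hq := F.q4_ne_zero
  have hu0 := F.u0h_ne_zero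
  have hu1 := F.u1h_ne_zero
  have hv0 := F.v0h_ne_zero
  have hv1 := F.v1h_ne_zero
  have hd := F.one_sub_q2_mul_u0_mul_u1_ne_zero
  have hP : P1const * (1 - F.q2 * F.u0 * F.u1) * (F.v0h * F.v1h) =
      F.q4 * F.u0h * F.v1h * (1 + F.u1) * (1 - F.v0) +
        F.u1h * F.v0h * (1 + F.q2 * F.u0) * (1 - F.v1) := by
    rw [P1const, div_mul_cancel₀ _ hd]
    field_simp
  generalize P1const = c at hP ⊢
  simp only [F.q2, F.u0, F.u1, F.v0, F.v1] at hP hd ⊢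
  generalize F.q4 = q at *
  generalize F.u0h = x at *
  generalize F.u1h = y at *
  generalize F.v0h = z at *
  generalize F.v1h = w at *
  congr 1
  · field_simp
    ring
  · field_simp
  · field_simp
    linear_combination (q ^ 2 - 1) * hP

end AskeyWilson

/-- with `Ŷ = Û₀ ∘ Û₁` and `Ŷ⁻¹ = Û₁' ∘ Û₀'`, the symmetric Askey–Wilson
polynomial `P₁` satisfies
`(Ŷ + Ŷ⁻¹)(P₁) = ((u₀u₁)^{1/2}·q^{1/2} + (u₀u₁)^{−1/2}·q^{−1/2})·P₁`. -/
theorem statement17 :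
    (∃ s : Fin 2 → Module.End F LF, Sconds s) ∧
    (∀ s : Fin 2 → Module.End F LF, Sconds s →
      ∃ U U' : Fin 2 → Module.End F LF, Uconds s U ∧ U'conds s U') ∧
    ∀ s U U' : Fin 2 → Module.End F LF, Sconds s → Uconds s U → U'conds s U' →
      U 0 (U 1 P1) + U' 1 (U' 0 P1) =
        (F.u0h * F.u1h * F.q2 + (F.u0h * F.u1h)⁻¹ * F.q2⁻¹) • P1 := by
  exact ⟨exists_Sconds, fun _ hs => hs.exists_Uconds_U'conds,
    fun _ _ _ hs hU hU' => P1_eigen hs hU hU'⟩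
end
end
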